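/- Let w be a permutation and let (i, j) be such that ℓ(w t_{ij}) = ℓ(w) − 1. For any reduced compatible sequence (r ; a) ∈ PD(w), the Edelman–Greene recording tableau is invariant under the Little bump: Q̃((r ; a)) = Q̃(L_{ij}(r ; a)). -/

import Mathlib

/- Common definitions for formalizing "Lenart's bijection via bumpless pipe dreams"
   (Gregory–Hamaker). -/

namespace BPDPaper

/-! ### Permutations of the positive integers -/

/-- We model permutations of the positive integers as permutations of `ℕ`
(fixing `0`, with finite support). -/
abbrev Perm' := Equiv.Perm ℕ

/-- The simple transposition `s_a = t_{a,a+1}`. -/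
def sT (a : ℕ) : Perm' := Equiv.swap a (a + 1)

/-- The transposition `t_{ij}`. -/
def tT (i j : ℕ) : Perm' := Equiv.swap i j

/-- The product `s_{a_1} ⋯ s_{a_p}` of a word. -/
def wordProd (l : List ℕ) : Perm' := (l.map sT).prod

/-- `l` is a word for `w` (in the letters `s_1, s_2, …`). -/
def IsWord (w : Perm') (l : List ℕ) : Prop := (∀ x ∈ l, 1 ≤ x) ∧ wordProd l = w

/-- The Coxeter length `ℓ(w)`: the minimal length of a word for `w`. -/
noncomputable def plen (w : Perm') : ℕ :=
  sInf {m | ∃ l : List ℕ, IsWord w l ∧ l.length = m}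

/-- `l` is a reduced word for `w`. -/
def IsReducedWord (w : Perm') (l : List ℕ) : Prop := IsWord w l ∧ l.length = plen w

/-- A permutation of the positive integers: fixes `0` and all but finitely many points. -/
def IsPerm (w : Perm') : Prop := w 0 = 0 ∧ {k | w k ≠ k}.Finite

/-- `k` is a descent of `w`. -/
def Descent (w : Perm') (k : ℕ) : Prop := 1 ≤ k ∧ w (k + 1) < w k

/-- `w` is Grassmannian: at most one descent. -/
def Grassmannian (w : Perm') : Prop := IsPerm w ∧ Set.Subsingleton {k | Descent w k}

/-- `w` is vexillary: no indices `i < j < k < l` with `w j < w i < w l < w k`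
(pattern 2143 avoidance). -/
def Vexillary (w : Perm') : Prop := IsPerm w ∧
  ¬ ∃ i j k l : ℕ, 1 ≤ i ∧ i < j ∧ j < k ∧ k < l ∧ w j < w i ∧ w i < w l ∧ w l < w k

/-- The code `c_i(w) = #{j > i : w j < w i}`. -/
noncomputable def codeOf (w : Perm') (i : ℕ) : ℕ := Nat.card {j : ℕ | i < j ∧ w j < w i}

/-- Insert into a weakly decreasing list, keeping it weakly decreasing. -/
def insDesc (x : ℕ) : List ℕ → List ℕ
  | [] => [x]
  | y :: ys => if y < x then x :: y :: ys else y :: insDesc x ys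

/-- Sort a list into weakly decreasing order. -/
def sortDesc (l : List ℕ) : List ℕ := l.foldr insDesc []

/-- The shape `λ(w)`: the code `(c_1(w), …, c_n(w))` sorted decreasingly, zeros dropped
(`n` is any bound on the support of `w`). -/
noncomputable def shapeOf (w : Perm') (n : ℕ) : List ℕ :=
  (sortDesc ((List.range' 1 n).map (codeOf w))).filter (fun x => decide (0 < x))

/-- The Rothe diagram `D_w = {(i, w j) : i < j, w j < w i}` (matrix coordinates). -/
def RotheDiagram (w : Perm') : Set (ℕ × ℕ) :=
  {p | 1 ≤ p.1 ∧ ∃ j, p.1 < j ∧ w j < w p.1 ∧ p.2 = w j}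

/-- `φ_i`: the row index of the southeast-most box of `D_w` on the diagonal through
`(i, λ_i)`. -/
noncomputable def flagEntry (w : Perm') (i li : ℕ) : ℕ :=
  sSup {r : ℕ | ∃ c : ℕ, (r, c) ∈ RotheDiagram w ∧ (c : ℤ) - (r : ℤ) = (li : ℤ) - (i : ℤ)}

/-- The flag `φ(w) = (φ_1, …, φ_m)` of a vexillary permutation. -/
noncomputable def flagOf (w : Perm') (n : ℕ) : List ℕ :=
  (List.range (shapeOf w n).length).map (fun k => flagEntry w (k + 1) ((shapeOf w n).getD k 0))

/-- `ρ(w)_i`: the `i`-th row of the smallest partition whose Young diagram contains `D_w`. -/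
noncomputable def rhoRow (w : Perm') (i : ℕ) : ℕ :=
  sSup {c : ℕ | ∃ r : ℕ, i ≤ r ∧ (r, c) ∈ RotheDiagram w}

/-! ### Tableaux (lists of rows), flagged SSYT, jeu de taquin -/

/-- Semistandard Young tableau of partition shape, presented as a list of rows. -/
def IsSSYT (T : List (List ℕ)) : Prop :=
  (∀ row ∈ T, row ≠ []) ∧
  List.Chain' (fun r1 r2 : List ℕ => r2.length ≤ r1.length) T ∧
  (∀ row ∈ T, List.Chain' (· ≤ ·) row) ∧
  (∀ i j : ℕ, i + 1 < T.length → j < (T.getD (i + 1) []).length →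
    (T.getD i []).getD j 0 < (T.getD (i + 1) []).getD j 0)

/-- `φ`-flagged semistandard Young tableaux of shape `λ`: the last entry of row `i`
is at most `φ_i`. -/
def IsFlaggedSSYT (lam phi : List ℕ) (T : List (List ℕ)) : Prop :=
  IsSSYT T ∧ T.map List.length = lam ∧
  ∀ i : ℕ, i < T.length → (T.getD i []).getLastD 0 ≤ phi.getD i 0

/-- Semistandard Young tableaux with all entries at most `k` (`SSYT_k`). -/
def IsSSYTBounded (k : ℕ) (T : List (List ℕ)) : Prop :=
  IsSSYT T ∧ ∀ row ∈ T, ∀ x ∈ row, x ≤ k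

/-- Set an entry of a tableau. -/
def setEntry (T : List (List ℕ)) (r c x : ℕ) : List (List ℕ) :=
  T.set r ((T.getD r []).set c x)

/-- One jeu de taquin slide with the empty tile at `(r, c)` (0-indexed):
swap the empty tile with the smaller of the entries to its right and below
(ties move down; missing boxes are `∞`); when both are missing, delete the cell. -/
def jdtAux : ℕ → List (List ℕ) → ℕ → ℕ → List (List ℕ)
  | 0, T, _, _ => T
  | fuel + 1, T, r, c =>
    match (T.getD r [])[c + 1]?, (T.getD (r + 1) [])[c]? with
    | none, none => (T.set r ((T.getD r []).take c)).filter (fun row => !row.isEmpty)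
    | some x, none => jdtAux fuel (setEntry T r c x) r (c + 1)
    | none, some y => jdtAux fuel (setEntry T r c y) (r + 1) c
    | some x, some y =>
      if x < y then jdtAux fuel (setEntry T r c x) r (c + 1)
      else jdtAux fuel (setEntry T r c y) (r + 1) c

/-- `jdt(T)`: remove the top-left box of `T` and rectify by jeu de taquin. -/
def jdt (T : List (List ℕ)) : List (List ℕ) :=
  jdtAux ((T.map List.length).sum + 1) T 0 0

/-! ### Edelman–Greene column insertion and the recording tableau -/

/-- Edelman–Greene insertion of `x` into one increasing column `C`.
Returns the new column together with `none` (if `x` was appended, creating a new box)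
or `some y` (where `y` is to be inserted into the next column). -/
def colIns (x : ℕ) (C : List ℕ) : List ℕ × Option ℕ :=
  if C.all (fun c => decide (c < x)) then (C ++ [x], none)
  else if x ∈ C ∧ (x + 1) ∈ C then (C, some (x + 1))
  else
    match C.find? (fun c => decide (x < c)) with
    | some ck => (C.map (fun c => if c = ck then x else c), some ck)
    | none => (C, none)

/-- Edelman–Greene insertion of `x` into a tableau presented as a list of columns.
Returns the new columns and the (0-indexed) column containing the new box. -/
def egInsert : List (List ℕ) → ℕ → (List (List ℕ)) × ℕ
  | [], x => ([[x]], 0)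
  | C :: rest, x =>
    match colIns x C with
    | (C', none) => (C' :: rest, 0)
    | (C', some y) =>
      let res := egInsert rest y
      (C' :: res.1, res.2 + 1)

/-- One step of the Edelman–Greene algorithm on the pair (insertion, recording) tableau:
insert `ra.2` into `P` and record `ra.1` in the new box of `Q`. -/
def egStep (PQ : (List (List ℕ)) × (List (List ℕ))) (ra : ℕ × ℕ) :
    (List (List ℕ)) × (List (List ℕ)) :=
  let res := egInsert PQ.1 ra.2
  let Q := PQ.2
  let Q' := if res.2 < Q.length then Q.set res.2 (Q.getD res.2 [] ++ [ra.1]) else Q ++ [[ra.1]]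
  (res.1, Q')

/-- A biword `(r_1,…,r_l ; a_1,…,a_l)`. -/
structure Biword where
  top : List ℕ
  bot : List ℕ

/-- The (insertion, recording) column tableaux of a biword under Edelman–Greene insertion. -/
def egPQ (P : Biword) : (List (List ℕ)) × (List (List ℕ)) :=
  (P.top.zip P.bot).foldl egStep ([], [])

/-- Convert a tableau presented as a list of columns into a list of rows. -/
def colsToRows (cols : List (List ℕ)) : List (List ℕ) :=
  (List.range ((cols.map List.length).foldr max 0)).map
    (fun i => cols.filterMap (fun col => col[i]?))

/-- The Edelman–Greene recording tableau `Q̃` of a biword (as a list of rows). -/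
def Qtilde (P : Biword) : List (List ℕ) := colsToRows (egPQ P).2

/-- The Edelman–Greene insertion tableau `P̃` of a biword (as a list of rows). -/
def Ptilde (P : Biword) : List (List ℕ) := colsToRows (egPQ P).1

/-- `(r ; a)` is a reduced compatible sequence for `w`: `a` is a reduced word for `w`,
`r` is weakly increasing, `r_i ≤ a_i`, and `r_i < r_{i+1}` whenever `a_i < a_{i+1}`.
Membership in `PD(w)`. -/
def IsCompatible (w : Perm') (P : Biword) : Prop :=
  IsReducedWord w P.bot ∧
  List.Chain' (· ≤ ·) P.top ∧
  List.Forall₂ (· ≤ ·) P.top P.bot ∧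
  (∀ m : ℕ, m + 1 < P.bot.length →
    P.bot.getD m 0 < P.bot.getD (m + 1) 0 → P.top.getD m 0 < P.top.getD (m + 1) 0)

/-! ### Bumpless pipe dreams -/

/-- The tiles: blank, vertical, horizontal, ⌐-elbow (S–E, "r"), ⌟-elbow (W–N, "j"),
crossing, and the bump tile (for almost bumpless pipe dreams). -/
inductive Tile
  | blank | vert | horiz | se | nw | cross | bump
deriving DecidableEq

/-- A square grid of tiles; rows and columns are 1-indexed, rows increase downward. -/
structure Grid where
  n : ℕ
  tile : ℕ → ℕ → Tile

inductive Dir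
  | north | east
deriving DecidableEq

def hasN : Tile → Bool
  | .vert => true | .nw => true | .cross => true | .bump => true | _ => false
def hasS : Tile → Bool
  | .vert => true | .se => true | .cross => true | .bump => true | _ => false
def hasE : Tile → Bool
  | .horiz => true | .se => true | .cross => true | .bump => true | _ => false
def hasW : Tile → Bool
  | .horiz => true | .nw => true | .cross => true | .bump => true | _ => false

/-- The outgoing direction of a pipe through a tile, given the incoming heading
(`north` = entered through the south edge, `east` = entered through the west edge). -/
def outDir : Tile → Dir → Option Dir
  | .vert, .north => some .north
  | .cross, .north => some .north
  | .se, .north => some .east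
  | .bump, .north => some .east
  | .horiz, .east => some .east
  | .cross, .east => some .east
  | .nw, .east => some .north
  | .bump, .east => some .north
  | _, _ => none

/-- Trace a pipe; returns the row in which it exits through the east edge of the grid. -/
def traceAux (g : Grid) : ℕ → ℕ → ℕ → Dir → Option ℕ
  | 0, _, _, _ => none
  | fuel + 1, x, y, d =>
    match outDir (g.tile x y) d with
    | none => none
    | some Dir.north => if x ≤ 1 then none else traceAux g fuel (x - 1) y Dir.north
    | some Dir.east => if g.n ≤ y then some x else traceAux g fuel x (y + 1) Dir.east

/-- The exit row of the pipe entering at the bottom of column `c`. -/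
def exitRow (g : Grid) (c : ℕ) : Option ℕ := traceAux g (2 * g.n + 2) g.n c Dir.north

/-- The list of states `(row, column, heading)` visited by a pipe. -/
def pathAux (g : Grid) : ℕ → ℕ → ℕ → Dir → List (ℕ × ℕ × Dir)
  | 0, _, _, _ => []
  | fuel + 1, x, y, d =>
    (x, y, d) ::
      (match outDir (g.tile x y) d with
       | none => []
       | some Dir.north => if x ≤ 1 then [] else pathAux g fuel (x - 1) y Dir.north
       | some Dir.east => if g.n ≤ y then [] else pathAux g fuel x (y + 1) Dir.east)

/-- The path of the pipe entering at the bottom of column `c`. -/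
def pipePath (g : Grid) (c : ℕ) : List (ℕ × ℕ × Dir) := pathAux g (2 * g.n + 2) g.n c Dir.north

/-- Pipe `c` passes through position `z`. -/
def passes (g : Grid) (c : ℕ) (z : ℕ × ℕ) : Prop :=
  ∃ d : Dir, (z.1, z.2, d) ∈ pipePath g c

def InGrid (g : Grid) (i j : ℕ) : Prop := 1 ≤ i ∧ i ≤ g.n ∧ 1 ≤ j ∧ j ≤ g.n

/-- A (reduced) bumpless pipe dream: tiles match along edges; pipes enter along the
bottom and exit along the right; no bump tiles; no two pipes cross more than once.
(Tiles outside the grid are normalized to `horiz`.) -/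
def IsBPD (g : Grid) : Prop :=
  1 ≤ g.n ∧
  (∀ i j, ¬ InGrid g i j → g.tile i j = Tile.horiz) ∧
  (∀ i j, InGrid g i j → g.tile i j ≠ Tile.bump) ∧
  (∀ i j, 1 ≤ i → i < g.n → 1 ≤ j → j ≤ g.n → hasS (g.tile i j) = hasN (g.tile (i + 1) j)) ∧
  (∀ i j, 1 ≤ i → i ≤ g.n → 1 ≤ j → j < g.n → hasE (g.tile i j) = hasW (g.tile i (j + 1))) ∧
  (∀ j, 1 ≤ j → j ≤ g.n → hasN (g.tile 1 j) = false) ∧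
  (∀ j, 1 ≤ j → j ≤ g.n → hasS (g.tile g.n j) = true) ∧
  (∀ i, 1 ≤ i → i ≤ g.n → hasW (g.tile i 1) = false) ∧
  (∀ i, 1 ≤ i → i ≤ g.n → hasE (g.tile i g.n) = true) ∧
  (∀ c c', 1 ≤ c → c ≤ g.n → 1 ≤ c' → c' ≤ g.n → c ≠ c' →
    Set.Subsingleton {z : ℕ × ℕ | g.tile z.1 z.2 = Tile.cross ∧ passes g c z ∧ passes g c' z})

/-- `g ∈ BPD(w)`: `g` is a bumpless pipe dream whose permutation is `w`, i.e. the pipe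
entering at the bottom of column `c` exits to the right in row `w⁻¹(c)`. -/
def MemBPD (w : Perm') (g : Grid) : Prop :=
  IsBPD g ∧ w 0 = 0 ∧ (∀ k, g.n < k → w k = k) ∧
  (∀ c, 1 ≤ c → c ≤ g.n → exitRow g c = some (w.symm c))

/-! ### Weigandt's map γ -/

/-- The blank tiles on the diagonal `{(i,j) : j - i = d}`, from northwest to southeast. -/
def blanksOnDiag (g : Grid) (d : ℤ) : List (ℕ × ℕ) :=
  (List.range' 1 g.n).filterMap (fun (i : ℕ) =>
    let jz : ℤ := (i : ℤ) + d
    if 1 ≤ jz ∧ jz ≤ (g.n : ℤ) then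
      (if g.tile i jz.toNat = Tile.blank then some (i, jz.toNat) else none)
    else none)

/-- The number of pipes passing above position `(i,j)`: tiles above it in column `j`
in which a pipe travels eastward. -/
def pipesAbove (g : Grid) (i j : ℕ) : ℕ :=
  ((List.range' 1 g.n).filter (fun x => decide (x < i) && hasE (g.tile x j))).length

/-- Weigandt's map `γ` (for vexillary permutations): fill each blank tile with the number
of pipes above it, slide the filled tiles northwest along their diagonals into the Young
diagram of `lam`, and add `i` to every entry in row `i`. -/
def weigandt (g : Grid) (lam : List ℕ) : List (List ℕ) :=
  (List.range lam.length).map (fun (r0 : ℕ) =>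
    (List.range (lam.getD r0 0)).map (fun (c0 : ℕ) =>
      let r : ℕ := r0 + 1
      let c : ℕ := c0 + 1
      let p := (blanksOnDiag g ((c : ℤ) - (r : ℤ))).getD (min r c - 1) (0, 0)
      pipesAbove g p.1 p.2 + r))

/-! ### The Gao–Huang operator ∇, pop, and the bijection φ -/

/-- Backward tracing: enter tile `(x,y)` through its north edge (`viaN = true`) or its
east edge (`viaN = false`) and follow the pipe backwards; returns the bottom column
at which the pipe enters the grid. -/
def backAux (g : Grid) : ℕ → ℕ → ℕ → Bool → Option ℕ
  | 0, _, _, _ => none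
  | fuel + 1, x, y, viaN =>
    if g.n < x then none
    else if viaN then
      match g.tile x y with
      | .vert | .cross => if x = g.n then some y else backAux g fuel (x + 1) y true
      | .nw | .bump => backAux g fuel x (y - 1) false
      | _ => none
    else
      match g.tile x y with
      | .horiz | .cross => backAux g fuel x (y - 1) false
      | .se | .bump => if x = g.n then some y else backAux g fuel (x + 1) y true
      | _ => none

/-- The label of the pipe passing through `(x,y)` entering from the south. -/
def pipeFromS (g : Grid) (x y : ℕ) : Option ℕ :=
  if x = g.n then some y else backAux g (2 * g.n + 2) (x + 1) y true

/-- Move the mark east to the rightmost blank tile in its contiguous block of blanks. -/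
def slideEast (g : Grid) (i j : ℕ) : ℕ :=
  ((List.range' j (g.n + 1)).takeWhile (fun y => g.tile i y == Tile.blank)).getLastD j

/-- Tile rewrite for the undroop of the pipe `p` (from `(i', j+1)` into `(i, j)`)
performed in one iteration of the Gao–Huang procedure; the `(i', j+1)` case `cross → se`
is the final uncrossing step. -/
def nablaUndroop (T : ℕ → ℕ → Tile) (i i' j : ℕ) : ℕ → ℕ → Tile := fun x y =>
  let t := T x y
  if x = i ∧ y = j then (match t with | Tile.blank => Tile.se | _ => t)
  else if x = i' ∧ y = j then
    (match t with | Tile.se => Tile.vert | Tile.horiz => Tile.nw | _ => t)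
  else if x = i ∧ y = j + 1 then
    (match t with | Tile.se => Tile.horiz | Tile.vert => Tile.nw | _ => t)
  else if x = i' ∧ y = j + 1 then
    (match t with | Tile.nw => Tile.blank | Tile.cross => Tile.se | _ => t)
  else if y = j ∧ i < x ∧ x < i' then
    (match t with | Tile.blank => Tile.vert | Tile.horiz => Tile.cross | _ => t)
  else if y = j + 1 ∧ i < x ∧ x < i' then
    (match t with | Tile.vert => Tile.blank | Tile.cross => Tile.horiz | _ => t)
  else t

/-- Tile rewrite for the droop (from `(k, j)` into `(k', j+1)`) of a pipe `q` having both
a ⌐-turn and a ⌟-turn in column `j`, performed after the undroop of `p`. -/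
def nablaQDroop (T : ℕ → ℕ → Tile) (k k' j : ℕ) : ℕ → ℕ → Tile := fun x y =>
  let t := T x y
  if x = k ∧ y = j then (match t with | Tile.se => Tile.vert | _ => t)
  else if x = k' ∧ y = j then (match t with | Tile.nw => Tile.cross | _ => t)
  else if x = k ∧ y = j + 1 then (match t with | Tile.horiz => Tile.se | _ => t)
  else if x = k' ∧ y = j + 1 then (match t with | Tile.blank => Tile.nw | _ => t)
  else if y = j + 1 ∧ k < x ∧ x < k' then
    (match t with | Tile.blank => Tile.vert | Tile.horiz => Tile.cross | _ => t)
  else t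

/-- The ⌐/⌟ elbow pairs `(k, k')` of pipes in column `j` strictly between rows `i` and `i'`. -/
def qPairs (g : Grid) (i i' j : ℕ) : List (ℕ × ℕ) :=
  (List.range' 1 g.n).filterMap (fun k =>
    if i < k ∧ k < i' ∧ g.tile k j = Tile.se then
      match (List.range' 1 g.n).find?
          (fun k' => decide (k < k' ∧ k' < i' ∧ g.tile k' j = Tile.nw)) with
      | some k' => some (k, k')
      | none => none
    else none)

/-- One iteration of the marked-tile procedure on the rectangle with corners
`(i, j)` and `(i', j+1)`: undroop `p`, then droop the intersecting pipes. -/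
def nablaIter (g : Grid) (i i' j : ℕ) : Grid :=
  ⟨g.n, (qPairs g i i' j).foldl (fun T kk => nablaQDroop T kk.1 kk.2 j)
    (nablaUndroop g.tile i i' j)⟩

/-- The marked-tile loop of the Gao–Huang procedure; returns `(∇B, a)`. -/
def nablaLoop (g : Grid) : ℕ → ℕ × ℕ → Grid × ℕ
  | 0, _ => (g, 0)
  | fuel + 1, (i, j0) =>
    let j := slideEast g i j0
    match pipeFromS g i (j + 1) with
    | none => (g, 0)
    | some p =>
      if p = j + 1 then
        match (List.range' 1 g.n).find? (fun x =>
            decide (i < x) && (g.tile x (j + 1) == Tile.cross) &&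
            (backAux g (2 * g.n + 2) x (j + 1) false == some j)) with
        | some i' => (nablaIter g i i' j, j)
        | none => (g, 0)
      else
        match (List.range' 1 g.n).find? (fun x =>
            decide (i < x) && (g.tile x (j + 1) == Tile.nw)) with
        | some i' => nablaLoop (nablaIter g i i' j) fuel (i', j + 1)
        | none => (g, 0)

/-- The Gao–Huang procedure: returns `(∇B, (r, a))` where `pop(B) = (r, a)`. -/
def nablaPop (g : Grid) : Grid × ℕ × ℕ :=
  match (List.range' 1 g.n).find?
      (fun i => (List.range' 1 g.n).any (fun j => g.tile i j == Tile.blank)) with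
  | none => (g, 0, 0)
  | some r =>
    let j0 := ((List.range' 1 g.n).filter (fun j => g.tile r j == Tile.blank)).getLastD 0
    let res := nablaLoop g (g.n + 1) (r, j0)
    (res.1, r, res.2)

/-- The Gao–Huang operator `∇`. -/
def nabla (g : Grid) : Grid := (nablaPop g).1

/-- `pop(B) = (r, a)`. -/
def pop (g : Grid) : ℕ × ℕ := (nablaPop g).2

/-- The number of crossing tiles of `g` (which equals `ℓ(w)` for `g ∈ BPD(w)`). -/
def crossCount (g : Grid) : ℕ :=
  ((List.range' 1 g.n).map (fun i =>
    ((List.range' 1 g.n).filter (fun j => g.tile i j == Tile.cross)).length)).sum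

def phiAux : ℕ → Grid → List (ℕ × ℕ)
  | 0, _ => []
  | l + 1, g => pop g :: phiAux l (nabla g)

/-- The Gao–Huang bijection `φ : BPD(w) → PD(w)`,
`φ(B) = (r_1,…,r_l ; a_1,…,a_l)` with `(r_i, a_i) = pop(∇^{i-1} B)`. -/
def phi (g : Grid) : Biword :=
  ⟨(phiAux (crossCount g) g).map Prod.fst, (phiAux (crossCount g) g).map Prod.snd⟩

/-! ### Little bumps (relational) -/

/-- The reflection labelling the crossing at position `m` (0-indexed) of the word `a`:
deleting the letter at position `m` from `a` yields a word for `wordProd a * crossingRefl a m`.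
The wires `i` and `j` cross at position `m` iff `crossingRefl a m = t_{ij}`. -/
def crossingRefl (a : List ℕ) (m : ℕ) : Perm' :=
  (wordProd (a.drop (m + 1)))⁻¹ * sT (a.getD m 0) * wordProd (a.drop (m + 1))

/-- `a` is a reduced word (for its own product). -/
def IsReducedSelf (a : List ℕ) : Prop := IsReducedWord (wordProd a) a

/-- Increment the entry of `a` at position `m`. -/
def incrAt (a : List ℕ) (m : ℕ) : List ℕ := a.set m (a.getD m 0 + 1)

/-- The (upward) Little bump `L_{ij}` as a relation on biwords: starting at the position
`m_1` where wires `i` and `j` cross, repeatedly increment the current entry; stop when the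
bottom word becomes reduced, and otherwise move to the unique other position whose crossing
involves the same pair of wires. -/
def LittleBumpRel (i j : ℕ) (P P' : Biword) : Prop :=
  P'.top = P.top ∧
  ∃ ms : List ℕ, ∃ ws : List (List ℕ),
    ms ≠ [] ∧
    ws.length = ms.length + 1 ∧
    ws.getD 0 [] = P.bot ∧
    ws.getLastD [] = P'.bot ∧
    (∀ t : ℕ, t < ms.length → ws.getD (t + 1) [] = incrAt (ws.getD t []) (ms.getD t 0)) ∧
    crossingRefl P.bot (ms.getD 0 0) = tT i j ∧
    (∀ t : ℕ, t + 1 < ms.length →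
      ¬ IsReducedSelf (ws.getD (t + 1) []) ∧
      ms.getD (t + 1) 0 ≠ ms.getD t 0 ∧
      crossingRefl (ws.getD (t + 1) []) (ms.getD t 0)
        = crossingRefl (ws.getD (t + 1) []) (ms.getD (t + 1) 0)) ∧
    IsReducedSelf P'.bot

/-! ### Huang bumps -/

/-- Least offset `t ≥ 1` satisfying `p` (searched up to `bound + 1`). -/
def leastOff (p : ℕ → Bool) (bound : ℕ) : ℕ :=
  ((List.range' 1 (bound + 1)).filter p).headD 1

/-- The southeast corner `(x + k, y + l)` of the min-droop at `(x, y)`: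
`k, l ≥ 1` minimal with `(x+k, y)` and `(x, y+l)` not crossing tiles. -/
def minDroopCorner (g : Grid) (x y : ℕ) : ℕ × ℕ :=
  (x + leastOff (fun k => !(g.tile (x + k) y == Tile.cross)) g.n,
   y + leastOff (fun l => !(g.tile x (y + l) == Tile.cross)) g.n)

/-- The min-droop at `(x, y)`: droop the ⌐-turn at `(x, y)` into `(x+k, y+l)`. -/
def minDroopT (g : Grid) (x y : ℕ) : Grid :=
  let k := leastOff (fun k => !(g.tile (x + k) y == Tile.cross)) g.n
  let l := leastOff (fun l => !(g.tile x (y + l) == Tile.cross)) g.n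
  ⟨g.n, fun a b =>
    let t := g.tile a b
    if a = x ∧ b = y then
      (match t with | Tile.se => Tile.blank | Tile.bump => Tile.nw | _ => t)
    else if a = x + k ∧ b = y then (match t with | Tile.vert => Tile.se | _ => t)
    else if a = x ∧ b = y + l then
      (match t with | Tile.horiz => Tile.se | Tile.nw => Tile.vert | _ => t)
    else if a = x + k ∧ b = y + l then
      (match t with | Tile.blank => Tile.nw | Tile.se => Tile.bump | _ => t)
    else if b = y ∧ x < a ∧ a < x + k then
      (match t with | Tile.cross => Tile.horiz | Tile.vert => Tile.blank | _ => t)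
    else if a = x ∧ y < b ∧ b < y + l then
      (match t with | Tile.cross => Tile.vert | Tile.horiz => Tile.blank | _ => t)
    else if a = x + k ∧ y < b ∧ b < y + l then
      (match t with | Tile.blank => Tile.horiz | Tile.vert => Tile.cross | _ => t)
    else if b = y + l ∧ x < a ∧ a < x + k then
      (match t with | Tile.blank => Tile.vert | Tile.horiz => Tile.cross | _ => t)
    else t⟩

/-- Replace a single tile. -/
def setTile (g : Grid) (x y : ℕ) (t : Tile) : Grid :=
  ⟨g.n, fun a b => if a = x ∧ b = y then t else g.tile a b⟩

/-- Pipe `c` passes through `(x, y)` (Boolean). -/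
def onPath (g : Grid) (c : ℕ) (x y : ℕ) : Bool :=
  decide ((x, y, Dir.north) ∈ pipePath g c) || decide ((x, y, Dir.east) ∈ pipePath g c)

/-- The position of the crossing tile where pipes `c` and `c'` cross, if any. -/
def findCrossing (g : Grid) (c c' : ℕ) : Option (ℕ × ℕ) :=
  (pipePath g c).findSome? (fun s =>
    if (g.tile s.1 s.2.1 == Tile.cross) && onPath g c' s.1 s.2.1 then some (s.1, s.2.1)
    else none)

/-- The column of the ⌐-turn of pipe `c` in row `row`, if any. -/
def seTurnCol (g : Grid) (c row : ℕ) : Option ℕ :=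
  (pipePath g c).findSome? (fun s =>
    if s.1 = row ∧ s.2.2 = Dir.north ∧
        (g.tile s.1 s.2.1 = Tile.se ∨ g.tile s.1 s.2.1 = Tile.bump) then some s.2.1
    else none)

/-- The iteration of the Huang bump: min-droops and cross-bump-swaps until a bump tile
is turned into a crossing tile. -/
def huangLoop (iPipe : ℕ) : ℕ → Grid → ℕ × ℕ → Grid
  | 0, g, _ => g
  | fuel + 1, g, (x, y) =>
    let c := minDroopCorner g x y
    let g1 := minDroopT g x y
    match g1.tile c.1 c.2 with
    | Tile.nw =>
      match seTurnCol g1 iPipe c.1 with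
      | some col => huangLoop iPipe fuel g1 (c.1, col)
      | none => g1
    | Tile.bump =>
      match backAux g1 (2 * g1.n + 2) c.1 c.2 false with
      | some q =>
        match findCrossing g1 iPipe q with
        | some z =>
          huangLoop iPipe fuel (setTile (setTile g1 c.1 c.2 Tile.cross) z.1 z.2 Tile.bump) z
        | none => setTile g1 c.1 c.2 Tile.cross
      | none => g1
    | _ => g1

/-- Fuel exceeding the number of states of the procedure. -/
def huangFuel (g : Grid) : ℕ := 7 ^ (g.n * g.n) * (g.n * g.n) + 2

/-- The Huang bump `H_{ij}`: replace the crossing of pipes `i` and `j` by a bump tile,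
then repeatedly min-droop and cross-bump-swap until a new crossing tile is created. -/
def huang (i j : ℕ) (g : Grid) : Grid :=
  match findCrossing g i j with
  | some z => huangLoop i (huangFuel g) (setTile g z.1 z.2 Tile.bump) z
  | none => g

/-! ### Words and products of simple transpositions -/

theorem wordProd_append (u v : List ℕ) : wordProd (u ++ v) = wordProd u * wordProd v := by
  simp [wordProd]

theorem wordProd_cons (x : ℕ) (v : List ℕ) : wordProd (x :: v) = sT x * wordProd v := by
  simp [wordProd]

theorem wordProd_nil : wordProd [] = 1 := by
  simp [wordProd]

theorem sT_mul_self (x : ℕ) : sT x * sT x = 1 := by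
  simp [sT]

theorem sT_comm {x y : ℕ} (h : x + 2 ≤ y) : sT x * sT y = sT y * sT x := by
  unfold sT
  ext k
  simp only [Equiv.Perm.coe_mul, Function.comp_apply, Equiv.swap_apply_def]
  grind

theorem sT_braid (x : ℕ) : sT x * sT (x + 1) * sT x = sT (x + 1) * sT x * sT (x + 1) := by
  unfold sT
  ext k
  simp only [Equiv.Perm.coe_mul, Function.comp_apply, Equiv.swap_apply_def]
  grind

theorem sT_apply_zero {x : ℕ} (h : 1 ≤ x) : sT x 0 = 0 := by
  unfold sT
  rw [Equiv.swap_apply_of_ne_of_ne] <;> omega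

theorem wordProd_apply_zero {v : List ℕ} (h : ∀ x ∈ v, 1 ≤ x) : wordProd v 0 = 0 := by
  induction v with
  | nil => simp [wordProd_nil]
  | cons x v ih =>
    rw [wordProd_cons, Equiv.Perm.mul_apply, ih (fun y hy => h y (by simp [hy])),
      sT_apply_zero (h x (by simp))]

/-- A word is reduced when it is no longer than any word with the same product. -/
theorem isReducedSelf_iff {a : List ℕ} : IsReducedSelf a ↔ (∀ x ∈ a, 1 ≤ x) ∧
    ∀ b : List ℕ, (∀ x ∈ b, 1 ≤ x) → wordProd b = wordProd a → a.length ≤ b.length := by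
  constructor
  · rintro ⟨⟨hpos, -⟩, hlen⟩
    refine ⟨hpos, fun b hb hba => ?_⟩
    rw [hlen]
    exact Nat.sInf_le ⟨b, ⟨hb, hba⟩, rfl⟩
  · rintro ⟨hpos, hmin⟩
    refine ⟨⟨hpos, rfl⟩, le_antisymm ?_ (Nat.sInf_le ⟨a, ⟨hpos, rfl⟩, rfl⟩)⟩
    refine le_csInf ⟨_, a, ⟨hpos, rfl⟩, rfl⟩ ?_
    rintro m ⟨b, ⟨hb, hba⟩, rfl⟩
    exact hmin b hb hba

theorem IsReducedSelf.congr {a b : List ℕ} (ha : IsReducedSelf a) (hb : ∀ x ∈ b, 1 ≤ x)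
    (hlen : b.length = a.length) (hprod : wordProd b = wordProd a) : IsReducedSelf b := by
  rw [isReducedSelf_iff] at ha ⊢
  exact ⟨hb, fun c hc hcb => hlen ▸ ha.2 c hc (hcb.trans hprod)⟩

/-! ### Reflections attached to the positions of a word -/

theorem crossingRefl_append_left {u v v' : List ℕ} (h : wordProd v = wordProd v') {m : ℕ}
    (hm : m < u.length) : crossingRefl (u ++ v) m = crossingRefl (u ++ v') m := by
  unfold crossingRefl
  rw [List.drop_append_of_le_length hm, List.drop_append_of_le_length hm, wordProd_append,
    wordProd_append, h]
  simp [List.getD, List.getElem?_append_left hm]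

theorem crossingRefl_append_right (u v : List ℕ) (j : ℕ) :
    crossingRefl (u ++ v) (u.length + j) = crossingRefl v j := by
  unfold crossingRefl
  have : (u ++ v).drop (u.length + j + 1) = v.drop (j + 1) := by
    rw [add_assoc, List.drop_append]; simp
  rw [this]
  simp [List.getD, List.getElem?_append_right]

theorem crossingRefl_cons_zero (x : ℕ) (v : List ℕ) :
    crossingRefl (x :: v) 0 = (wordProd v)⁻¹ * sT x * wordProd v := by
  simp [crossingRefl]

theorem crossingRefl_cons_succ (x : ℕ) (v : List ℕ) (m : ℕ) :
    crossingRefl (x :: v) (m + 1) = crossingRefl v m := by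
  simp [crossingRefl, List.getD]

theorem crossingRefl_cons_one (x : ℕ) (v : List ℕ) :
    crossingRefl (x :: v) 1 = crossingRefl v 0 := crossingRefl_cons_succ x v 0

theorem crossingRefl_cons_two (x : ℕ) (v : List ℕ) :
    crossingRefl (x :: v) 2 = crossingRefl v 1 := crossingRefl_cons_succ x v 1

theorem crossingRefl_append_length (u v : List ℕ) :
    crossingRefl (u ++ v) u.length = crossingRefl v 0 := crossingRefl_append_right u v 0

theorem crossingRefl_apply_zero {v : List ℕ} (h : ∀ x ∈ v, 1 ≤ x) {m : ℕ} (hm : m < v.length) :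
    crossingRefl v m 0 = 0 := by
  have h1 : wordProd (v.drop (m + 1)) 0 = 0 :=
    wordProd_apply_zero fun x hx => h x (List.mem_of_mem_drop hx)
  have h2 : sT (v.getD m 0) 0 = 0 := by
    apply sT_apply_zero
    rw [List.getD_eq_getElem _ _ hm]
    exact h _ (List.getElem_mem hm)
  unfold crossingRefl
  rw [Equiv.Perm.mul_apply, Equiv.Perm.mul_apply, h1, h2, Equiv.Perm.inv_eq_iff_eq, h1]

theorem lt_length_of_crossingRefl_eq {v : List ℕ} (h : ∀ x ∈ v, 1 ≤ x) {m m' : ℕ}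
    (hm : m < v.length) (heq : crossingRefl v m = crossingRefl v m') : m' < v.length := by
  by_contra hm'
  have h0 := crossingRefl_apply_zero h hm
  rw [heq, crossingRefl, List.drop_eq_nil_of_le (by omega), wordProd_nil] at h0
  simp [List.getD, List.getElem?_eq_none (by omega : v.length ≤ m'), sT] at h0

/-- Deleting the letter in position `m` multiplies the product by the reflection at `m`. -/
theorem wordProd_eraseIdx {v : List ℕ} {m : ℕ} (hm : m < v.length) :
    wordProd (v.eraseIdx m) = wordProd v * crossingRefl v m := by
  induction v generalizing m with
  | nil => simp at hm
  | cons x v ih =>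
    cases m with
    | zero =>
      rw [crossingRefl_cons_zero, wordProd_cons, List.eraseIdx_cons_zero]
      have := sT_mul_self x
      calc wordProd v = (sT x * sT x) * wordProd v := by rw [this, one_mul]
        _ = _ := by group
    | succ m =>
      rw [crossingRefl_cons_succ, wordProd_cons, List.eraseIdx_cons_succ, wordProd_cons,
        ih (by simpa using hm), mul_assoc]

theorem crossingRefl_mul_self (v : List ℕ) (m : ℕ) :
    crossingRefl v m * crossingRefl v m = 1 := by
  have := sT_mul_self (v.getD m 0)
  unfold crossingRefl
  calc _ = (wordProd (v.drop (m + 1)))⁻¹ * (sT (v.getD m 0) * sT (v.getD m 0)) *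
      wordProd (v.drop (m + 1)) := by group
    _ = 1 := by rw [this]; group

/-- Positions to the right of a deleted letter keep their reflections. -/
theorem crossingRefl_eraseIdx_of_le {v : List ℕ} {m k : ℕ} (h : m ≤ k) (hm : m < v.length) :
    crossingRefl (v.eraseIdx m) k = crossingRefl v (k + 1) := by
  induction v generalizing m k with
  | nil => simp at hm
  | cons x v ih =>
    cases m with
    | zero => rw [crossingRefl_cons_succ, List.eraseIdx_cons_zero]
    | succ m =>
      obtain ⟨k, rfl⟩ : ∃ k', k = k' + 1 := ⟨k - 1, by omega⟩
      rw [crossingRefl_cons_succ, List.eraseIdx_cons_succ, crossingRefl_cons_succ,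
        ih (by omega) (by simpa using hm)]

/-- Deleting two letters with the same reflection does not change the product. -/
theorem exists_wordProd_eq_of_crossingRefl_eq {v : List ℕ} {p q : ℕ} (hpq : p < q)
    (hq : q < v.length) (h : crossingRefl v p = crossingRefl v q) :
    ∃ u : List ℕ, u.Sublist v ∧ u.length + 2 = v.length ∧ wordProd u = wordProd v := by
  obtain ⟨q, rfl⟩ : ∃ q', q = q' + 1 := ⟨q - 1, by omega⟩
  have hp : p < v.length := by omega
  have hl : (v.eraseIdx p).length = v.length - 1 := List.length_eraseIdx_of_lt hp
  refine ⟨(v.eraseIdx p).eraseIdx q,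
    (List.eraseIdx_sublist _ _).trans (List.eraseIdx_sublist _ _), ?_, ?_⟩
  · rw [List.length_eraseIdx_of_lt (by omega)]; omega
  · rw [wordProd_eraseIdx (by omega), wordProd_eraseIdx hp,
      crossingRefl_eraseIdx_of_le (by omega) hp, ← h, mul_assoc, crossingRefl_mul_self, mul_one]

theorem IsReducedSelf.crossingRefl_ne {v : List ℕ} (hv : IsReducedSelf v) {p q : ℕ} (hpq : p ≠ q)
    (hp : p < v.length) (hq : q < v.length) : crossingRefl v p ≠ crossingRefl v q := by
  intro h
  wlog hlt : p < q generalizing p q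
  · exact this hpq.symm hq hp h.symm (by omega)
  obtain ⟨u, hsub, hlen, hprod⟩ := exists_wordProd_eq_of_crossingRefl_eq hlt hq h
  rw [isReducedSelf_iff] at hv
  have := hv.2 u (fun x hx => hv.1 x (hsub.subset hx)) hprod
  omega

/-- Three letters with the same reflection cannot occur in a nearly reduced word. -/
theorem not_three_crossingRefl_eq {v : List ℕ} {m p q : ℕ} (hpos : ∀ x ∈ v, 1 ≤ x)
    (hm : m < v.length) (hv : IsReducedSelf (v.eraseIdx m)) (hpm : p < q) (hqm : q < v.length)
    (hp : p ≠ m) (hq : q ≠ m)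
    (hmp : crossingRefl v m = crossingRefl v p) (hmq : crossingRefl v m = crossingRefl v q) :
    False := by
  have key : ∀ a b c, a < b → b < c → c < v.length → crossingRefl v m = crossingRefl v a →
      crossingRefl v m = crossingRefl v b → crossingRefl v m = crossingRefl v c → False := by
    intro a b c hab hbc hc ha hb hc'
    have hl : (v.eraseIdx a).length = v.length - 1 := List.length_eraseIdx_of_lt (by omega)
    obtain ⟨b, rfl⟩ : ∃ b', b = b' + 1 := ⟨b - 1, by omega⟩
    obtain ⟨c, rfl⟩ : ∃ c', c = c' + 1 := ⟨c - 1, by omega⟩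
    obtain ⟨u, hsub, hlen, hprod⟩ := exists_wordProd_eq_of_crossingRefl_eq
      (v := v.eraseIdx a) (p := b) (q := c) (by omega) (by omega) (by
        rw [crossingRefl_eraseIdx_of_le (by omega) (by omega),
          crossingRefl_eraseIdx_of_le (by omega) (by omega), ← hb, ← hc'])
    rw [isReducedSelf_iff] at hv
    have hle := hv.2 u
      (fun x hx => hpos x ((List.eraseIdx_sublist _ _).subset (hsub.subset hx)))
      (by rw [hprod, wordProd_eraseIdx (by omega), wordProd_eraseIdx hm, ha])
    rw [List.length_eraseIdx_of_lt hm] at hle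
    omega
  rcases lt_or_gt_of_ne hp with h1 | h1
  · rcases lt_or_gt_of_ne hq with h2 | h2
    · exact key p q m hpm h2 hm hmp hmq rfl
    · exact key p m q h1 h2 hqm hmp rfl hmq
  · exact key m p q h1 hpm hqm rfl hmp hmq

theorem crossingRefl_unique {v : List ℕ} {m p q : ℕ} (hpos : ∀ x ∈ v, 1 ≤ x)
    (hm : m < v.length) (hv : IsReducedSelf (v.eraseIdx m)) (hp : p ≠ m) (hq : q ≠ m)
    (hmp : crossingRefl v m = crossingRefl v p) (hmq : crossingRefl v m = crossingRefl v q) :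
    p = q := by
  have hpl := lt_length_of_crossingRefl_eq hpos hm hmp
  have hql := lt_length_of_crossingRefl_eq hpos hm hmq
  rcases lt_trichotomy p q with h | h | h
  · exact (not_three_crossingRefl_eq hpos hm hv h hql hp hq hmp hmq).elim
  · exact h
  · exact (not_three_crossingRefl_eq hpos hm hv h hpl hq hp hmq hmp).elim

/-! ### The Little bump as a marked-word process -/

/-- The letters of `v` are positive, and deleting the marked letter leaves a reduced word. -/
structure NearlyReduced (v : List ℕ) (m : ℕ) : Prop where
  pos : ∀ x ∈ v, 1 ≤ x
  lt : m < v.length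
  red : IsReducedSelf (v.eraseIdx m)

/-- `Bump n v m b`: starting with the letter at position `m` of `v`, the Little bump takes `n`
steps and ends with `b`. -/
inductive Bump : ℕ → List ℕ → ℕ → List ℕ → Prop
  | halt {v : List ℕ} {m : ℕ} : IsReducedSelf (incrAt v m) → Bump 1 v m (incrAt v m)
  | step {n : ℕ} {v : List ℕ} {m m' : ℕ} {b : List ℕ} : ¬ IsReducedSelf (incrAt v m) → m' ≠ m →
      crossingRefl (incrAt v m) m = crossingRefl (incrAt v m) m' →
      Bump n (incrAt v m) m' b → Bump (n + 1) v m b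

theorem length_incrAt (v : List ℕ) (m : ℕ) : (incrAt v m).length = v.length := by
  simp [incrAt]

theorem eraseIdx_incrAt (v : List ℕ) (m : ℕ) : (incrAt v m).eraseIdx m = v.eraseIdx m := by
  simp [incrAt, List.eraseIdx_set_eq]

theorem incrAt_append_left {u : List ℕ} (v : List ℕ) {m : ℕ} (hm : m < u.length) :
    incrAt (u ++ v) m = incrAt u m ++ v := by
  simp [incrAt, List.getD, List.getElem?_append_left hm, List.set_append_left, hm]

theorem incrAt_append_right (u v : List ℕ) (j : ℕ) :
    incrAt (u ++ v) (u.length + j) = u ++ incrAt v j := by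
  simp [incrAt, List.getD, List.set_append_right, List.getElem?_append_right]

theorem incrAt_pos {v : List ℕ} (h : ∀ x ∈ v, 1 ≤ x) (m : ℕ) : ∀ x ∈ incrAt v m, 1 ≤ x := by
  intro x hx
  rcases List.mem_or_eq_of_mem_set hx with hx | rfl
  · exact h x hx
  · omega

theorem NearlyReduced.incrAt {v : List ℕ} {m : ℕ} (h : NearlyReduced v m) :
    NearlyReduced (incrAt v m) m :=
  ⟨incrAt_pos h.pos m, by simpa [length_incrAt] using h.lt, by
    rw [eraseIdx_incrAt]; exact h.red⟩

theorem NearlyReduced.congr {v v' : List ℕ} {m m' : ℕ} (h : NearlyReduced v m)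
    (hpos : ∀ x ∈ v', 1 ≤ x) (hm' : m' < v'.length) (hlen : v'.length = v.length)
    (hprod : wordProd v' = wordProd v) (heq : crossingRefl v m = crossingRefl v' m') :
    NearlyReduced v' m' := by
  refine ⟨hpos, hm', h.red.congr
    (fun x hx => hpos x ((List.eraseIdx_sublist _ _).subset hx)) ?_ ?_⟩
  · rw [List.length_eraseIdx_of_lt h.lt, List.length_eraseIdx_of_lt hm', hlen]
  · rw [wordProd_eraseIdx h.lt, wordProd_eraseIdx hm', heq, hprod]

theorem NearlyReduced.move {v : List ℕ} {m m' : ℕ} (h : NearlyReduced v m)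
    (heq : crossingRefl v m = crossingRefl v m') : NearlyReduced v m' :=
  h.congr h.pos (lt_length_of_crossingRefl_eq h.pos h.lt heq) rfl rfl heq

theorem Bump.length_eq {n : ℕ} {v : List ℕ} {m : ℕ} {b : List ℕ} (h : Bump n v m b) :
    b.length = v.length := by
  induction h with
  | halt h => exact length_incrAt _ _
  | step _ _ _ _ ih => rw [ih, length_incrAt]

/-- `ForcedMove v m v' m'`: after incrementing position `m` of `v`, the bump must proceed to
position `m'` of `v'`. -/
def ForcedMove (v : List ℕ) (m : ℕ) (v' : List ℕ) (m' : ℕ) : Prop :=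
  v' = incrAt v m ∧ m' ≠ m ∧ m' < v.length ∧ crossingRefl v' m = crossingRefl v' m'

theorem ForcedMove.not_isReducedSelf {v v' : List ℕ} {m m' : ℕ} (h : ForcedMove v m v' m')
    (hm : m < v.length) : ¬ IsReducedSelf v' := by
  obtain ⟨rfl, hne, hlt, heq⟩ := h
  intro hred
  exact hred.crossingRefl_ne hne.symm (by rwa [length_incrAt]) (by rwa [length_incrAt]) heq

theorem ForcedMove.bump {v v' : List ℕ} {m m' n : ℕ} {b : List ℕ} (h : ForcedMove v m v' m')
    (hm : m < v.length) (hb : Bump n v' m' b) : Bump (n + 1) v m b := by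
  have hn := h.not_isReducedSelf hm
  obtain ⟨rfl, hne, hlt, heq⟩ := h
  exact Bump.step hn hne heq hb

theorem ForcedMove.nearlyReduced {v v' : List ℕ} {m m' : ℕ} (h : ForcedMove v m v' m')
    (hv : NearlyReduced v m) : NearlyReduced v' m' := by
  obtain ⟨rfl, -, -, heq⟩ := h
  exact hv.incrAt.move heq

theorem Bump.of_forcedMove {v v' : List ℕ} {m m' n : ℕ} {b : List ℕ} (hb : Bump n v m b)
    (hv : NearlyReduced v m) (h : ForcedMove v m v' m') : ∃ n', n' < n ∧ Bump n' v' m' b := by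
  have hn := h.not_isReducedSelf hv.lt
  obtain ⟨rfl, hne, hlt, heq⟩ := h
  cases hb with
  | halt h => exact (hn h).elim
  | @step n _ _ m'' _ _ hne' heq' hb =>
    obtain rfl := crossingRefl_unique hv.incrAt.pos hv.incrAt.lt hv.incrAt.red hne hne' heq heq'
    exact ⟨n, by omega, hb⟩

/-! ### Coxeter–Knuth moves -/

/-- `CKMove k v v' σ`: the words `v` and `v'` differ by a Coxeter–Knuth move on the three letters
starting at position `k`, written in one of the two directions, and `σ` matches the positions
carrying the same reflection. -/
inductive CKMove : ℕ → List ℕ → List ℕ → Equiv.Perm ℕ → Prop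
  | left (A B : List ℕ) {x y z : ℕ} (hxz : x < z) (hzy : z < y) :
      CKMove A.length (A ++ x :: y :: z :: B) (A ++ y :: x :: z :: B)
        (Equiv.swap A.length (A.length + 1))
  | right (A B : List ℕ) {x y z : ℕ} (hyx : y < x) (hxz : x < z) :
      CKMove A.length (A ++ x :: y :: z :: B) (A ++ x :: z :: y :: B)
        (Equiv.swap (A.length + 1) (A.length + 2))
  | braid (A B : List ℕ) (x : ℕ) :
      CKMove A.length (A ++ x :: (x + 1) :: x :: B) (A ++ (x + 1) :: x :: (x + 1) :: B)
        (Equiv.swap A.length (A.length + 2))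

/-- The symmetric closure of `CKMove`. -/
def CKRel (k : ℕ) (v v' : List ℕ) (σ : Equiv.Perm ℕ) : Prop := CKMove k v v' σ ∨ CKMove k v' v σ

theorem CKRel.symm {k : ℕ} {v v' : List ℕ} {σ : Equiv.Perm ℕ} (h : CKRel k v v' σ) :
    CKRel k v' v σ := Or.symm h

theorem CKMove.length_eq {k : ℕ} {v v' : List ℕ} {σ : Equiv.Perm ℕ} (h : CKMove k v v' σ) :
    v'.length = v.length := by
  cases h <;> simp

theorem CKMove.wordProd_eq {k : ℕ} {v v' : List ℕ} {σ : Equiv.Perm ℕ} (h : CKMove k v v' σ) :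
    wordProd v' = wordProd v := by
  cases h with
  | left A B hxz hzy =>
    rename_i x y z
    have hc : sT x * sT y = sT y * sT x := sT_comm (by omega)
    simp only [wordProd_append, wordProd_cons]
    rw [← mul_assoc (sT x) (sT y), hc, mul_assoc]
  | right A B hyx hxz =>
    rename_i x y z
    have hc : sT y * sT z = sT z * sT y := sT_comm (by omega)
    simp only [wordProd_append, wordProd_cons]
    rw [← mul_assoc (sT y) (sT z), hc, mul_assoc]
  | braid A B x =>
    simp only [wordProd_append, wordProd_cons]
    rw [← mul_assoc (sT _) (sT _) (_ * _), ← mul_assoc (sT _) (sT _) (_ * _),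
      ← mul_assoc (sT _ * sT _) _ _, ← mul_assoc (sT _ * sT _) _ _, sT_braid]

theorem CKMove.pos {k : ℕ} {v v' : List ℕ} {σ : Equiv.Perm ℕ} (h : CKMove k v v' σ) :
    (∀ x ∈ v', 1 ≤ x) ↔ ∀ x ∈ v, 1 ≤ x := by
  cases h <;> grind

theorem CKMove.involutive {k : ℕ} {v v' : List ℕ} {σ : Equiv.Perm ℕ} (h : CKMove k v v' σ)
    (m : ℕ) : σ (σ m) = m := by
  cases h <;> simp

theorem inv_mul_conj (s g : Perm') (hs : s * s = 1) :
    (s * g)⁻¹ * s * (s * g) = g⁻¹ * s * g := by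
  have : s⁻¹ = s := inv_eq_of_mul_eq_one_left hs
  rw [mul_inv_rev, this]
  calc _ = g⁻¹ * (s * s) * s * g := by group
    _ = _ := by rw [hs, mul_one]

theorem conj_of_commute (s t g : Perm') (h : s * t = t * s) :
    (t * g)⁻¹ * s * (t * g) = g⁻¹ * s * g := by
  calc _ = g⁻¹ * t⁻¹ * (s * t) * g := by group
    _ = _ := by rw [h]; group

theorem conj_of_braid (s t g : Perm') (h : s * t * s = t * s * t) :
    (t * (s * g))⁻¹ * s * (t * (s * g)) = g⁻¹ * t * g := by
  calc _ = g⁻¹ * s⁻¹ * t⁻¹ * (s * t * s) * g := by group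
    _ = _ := by rw [h]; group

theorem conj_of_braid_middle (s t g : Perm') (hs : s * s = 1) (ht : t * t = 1)
    (h : s * t * s = t * s * t) :
    (s * g)⁻¹ * t * (s * g) = (t * g)⁻¹ * s * (t * g) := by
  have hs' : s⁻¹ = s := inv_eq_of_mul_eq_one_left hs
  have ht' : t⁻¹ = t := inv_eq_of_mul_eq_one_left ht
  rw [mul_inv_rev, mul_inv_rev, hs', ht']
  calc _ = g⁻¹ * (s * t * s) * g := by group
    _ = _ := by rw [h]; group

theorem CKMove.crossingRefl_eq {k : ℕ} {v v' : List ℕ} {σ : Equiv.Perm ℕ} (h : CKMove k v v' σ)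
    (m : ℕ) : crossingRefl v m = crossingRefl v' (σ m) := by
  have hw := h.wordProd_eq
  cases h with
  | left A B hxz hzy =>
    rename_i x y z
    rw [wordProd_append, wordProd_append, mul_right_inj] at hw
    rcases lt_or_ge m A.length with hm | hm
    · rw [Equiv.swap_apply_of_ne_of_ne (by omega) (by omega),
        crossingRefl_append_left hw.symm hm]
    obtain ⟨j, rfl⟩ := Nat.exists_eq_add_of_le hm
    have hc : sT x * sT y = sT y * sT x := sT_comm (by omega)
    rcases j with _ | _ | j
    · rw [add_zero, Equiv.swap_apply_left,
        crossingRefl_append_length, crossingRefl_append_right]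
      simp only [crossingRefl_cons_zero, crossingRefl_cons_one, wordProd_cons]
      exact conj_of_commute _ _ _ hc
    · rw [zero_add, Equiv.swap_apply_right,
        crossingRefl_append_length, crossingRefl_append_right]
      simp only [crossingRefl_cons_zero, crossingRefl_cons_one, wordProd_cons]
      exact (conj_of_commute _ _ _ hc.symm).symm
    · rw [Equiv.swap_apply_of_ne_of_ne (by omega) (by omega),
        crossingRefl_append_right, crossingRefl_append_right]
      simp only [crossingRefl_cons_succ]
  | right A B hyx hxz =>
    rename_i x y z
    rw [wordProd_append, wordProd_append, mul_right_inj] at hw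
    rcases lt_or_ge m A.length with hm | hm
    · rw [Equiv.swap_apply_of_ne_of_ne (by omega) (by omega),
        crossingRefl_append_left hw.symm hm]
    obtain ⟨j, rfl⟩ := Nat.exists_eq_add_of_le hm
    have hc : sT y * sT z = sT z * sT y := sT_comm (by omega)
    rcases j with _ | _ | _ | j
    · rw [Equiv.swap_apply_of_ne_of_ne (by omega) (by omega),
        crossingRefl_append_right, crossingRefl_append_right]
      simp only [crossingRefl_cons_zero]
      rw [wordProd_cons x, wordProd_cons x, mul_right_inj] at hw
      rw [hw]
    · rw [zero_add, Equiv.swap_apply_left, crossingRefl_append_right, crossingRefl_append_right]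
      simp only [crossingRefl_cons_zero, crossingRefl_cons_one, crossingRefl_cons_two,
        wordProd_cons]
      exact conj_of_commute _ _ _ hc
    · rw [zero_add, one_add_one_eq_two, Equiv.swap_apply_right, crossingRefl_append_right,
        crossingRefl_append_right]
      simp only [crossingRefl_cons_zero, crossingRefl_cons_one, crossingRefl_cons_two,
        wordProd_cons]
      exact (conj_of_commute _ _ _ hc.symm).symm
    · rw [Equiv.swap_apply_of_ne_of_ne (by omega) (by omega),
        crossingRefl_append_right, crossingRefl_append_right]
      simp only [crossingRefl_cons_succ]
  | braid A B x =>
    rw [wordProd_append, wordProd_append, mul_right_inj] at hw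
    rcases lt_or_ge m A.length with hm | hm
    · rw [Equiv.swap_apply_of_ne_of_ne (by omega) (by omega),
        crossingRefl_append_left hw.symm hm]
    obtain ⟨j, rfl⟩ := Nat.exists_eq_add_of_le hm
    have hb := sT_braid x
    rcases j with _ | _ | _ | j
    · rw [add_zero, Equiv.swap_apply_left,
        crossingRefl_append_length, crossingRefl_append_right]
      simp only [crossingRefl_cons_zero, crossingRefl_cons_one, crossingRefl_cons_two,
        wordProd_cons]
      exact conj_of_braid _ _ _ hb
    · rw [Equiv.swap_apply_of_ne_of_ne (by omega) (by omega),
        crossingRefl_append_right, crossingRefl_append_right]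
      simp only [crossingRefl_cons_zero, crossingRefl_cons_succ, wordProd_cons]
      exact conj_of_braid_middle _ _ _ (sT_mul_self _) (sT_mul_self _) hb
    · rw [zero_add, one_add_one_eq_two, Equiv.swap_apply_right,
        crossingRefl_append_length, crossingRefl_append_right]
      simp only [crossingRefl_cons_zero, crossingRefl_cons_one, crossingRefl_cons_two,
        wordProd_cons]
      exact (conj_of_braid _ _ _ hb.symm).symm
    · rw [Equiv.swap_apply_of_ne_of_ne (by omega) (by omega),
        crossingRefl_append_right, crossingRefl_append_right]
      simp only [crossingRefl_cons_succ]

theorem CKRel.length_eq {k : ℕ} {v v' : List ℕ} {σ : Equiv.Perm ℕ} (h : CKRel k v v' σ) :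
    v'.length = v.length := h.elim CKMove.length_eq fun h => h.length_eq.symm

theorem CKRel.wordProd_eq {k : ℕ} {v v' : List ℕ} {σ : Equiv.Perm ℕ} (h : CKRel k v v' σ) :
    wordProd v' = wordProd v := h.elim CKMove.wordProd_eq fun h => h.wordProd_eq.symm

theorem CKRel.pos {k : ℕ} {v v' : List ℕ} {σ : Equiv.Perm ℕ} (h : CKRel k v v' σ) :
    (∀ x ∈ v', 1 ≤ x) ↔ ∀ x ∈ v, 1 ≤ x := h.elim CKMove.pos fun h => h.pos.symm

theorem CKRel.involutive {k : ℕ} {v v' : List ℕ} {σ : Equiv.Perm ℕ} (h : CKRel k v v' σ)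
    (m : ℕ) : σ (σ m) = m := h.elim (fun h => h.involutive m) fun h => h.involutive m

theorem CKRel.crossingRefl_eq {k : ℕ} {v v' : List ℕ} {σ : Equiv.Perm ℕ} (h : CKRel k v v' σ)
    (m : ℕ) : crossingRefl v m = crossingRefl v' (σ m) := by
  rcases h with h | h
  · exact h.crossingRefl_eq m
  · rw [h.crossingRefl_eq, h.involutive]

theorem CKRel.isReducedSelf {k : ℕ} {v v' : List ℕ} {σ : Equiv.Perm ℕ} (h : CKRel k v v' σ)
    (hv : IsReducedSelf v) : IsReducedSelf v' :=
  hv.congr (h.pos.2 (isReducedSelf_iff.1 hv).1) h.length_eq h.wordProd_eq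

theorem CKRel.nearlyReduced {k : ℕ} {v v' : List ℕ} {σ : Equiv.Perm ℕ} (h : CKRel k v v' σ)
    {m : ℕ} (hv : NearlyReduced v m) : NearlyReduced v' (σ m) := by
  have hpos := h.pos.2 hv.pos
  have heq := h.crossingRefl_eq m
  refine hv.congr hpos ?_ h.length_eq h.wordProd_eq heq
  by_contra hlt
  have h0 := crossingRefl_apply_zero hv.pos hv.lt
  rw [heq, crossingRefl, List.drop_eq_nil_of_le (by omega), wordProd_nil] at h0
  simp [List.getD, List.getElem?_eq_none (by omega : v'.length ≤ σ m), sT] at h0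

/-! ### Little bumps and Coxeter–Knuth moves -/

theorem incrAt_append_length (u v : List ℕ) : incrAt (u ++ v) u.length = u ++ incrAt v 0 :=
  incrAt_append_right u v 0

theorem incrAt_cons_zero (x : ℕ) (v : List ℕ) : incrAt (x :: v) 0 = (x + 1) :: v := by
  simp [incrAt]

theorem incrAt_cons_succ (x : ℕ) (v : List ℕ) (j : ℕ) :
    incrAt (x :: v) (j + 1) = x :: incrAt v j := by
  simp [incrAt]

theorem incrAt_cons_one (x : ℕ) (v : List ℕ) : incrAt (x :: v) 1 = x :: incrAt v 0 :=
  incrAt_cons_succ x v 0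

theorem incrAt_cons_two (x : ℕ) (v : List ℕ) : incrAt (x :: v) 2 = x :: incrAt v 1 :=
  incrAt_cons_succ x v 1

theorem crossingRefl_eq_of_adjacent (A B : List ℕ) (x : ℕ) :
    crossingRefl (A ++ x :: x :: B) A.length = crossingRefl (A ++ x :: x :: B) (A.length + 1) := by
  rw [crossingRefl_append_length, crossingRefl_append_right, crossingRefl_cons_one,
    crossingRefl_cons_zero, crossingRefl_cons_zero, wordProd_cons,
    inv_mul_conj _ _ (sT_mul_self x)]

theorem crossingRefl_eq_of_commute (A B : List ℕ) {x y : ℕ} (h : sT x * sT y = sT y * sT x) :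
    crossingRefl (A ++ x :: y :: x :: B) A.length =
      crossingRefl (A ++ x :: y :: x :: B) (A.length + 2) := by
  rw [crossingRefl_append_length, crossingRefl_append_right, crossingRefl_cons_two,
    crossingRefl_cons_one, crossingRefl_cons_zero, crossingRefl_cons_zero, wordProd_cons,
    wordProd_cons, conj_of_commute _ _ _ h, inv_mul_conj _ _ (sT_mul_self x)]

theorem CKRel.left {A : List ℕ} {k : ℕ} (hk : A.length = k) (B : List ℕ) {x y z : ℕ}
    (hxz : x < z) (hzy : z < y) :
    CKRel k (A ++ x :: y :: z :: B) (A ++ y :: x :: z :: B) (Equiv.swap k (k + 1)) := by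
  subst hk; exact Or.inl (CKMove.left A B hxz hzy)

theorem CKRel.right {A : List ℕ} {k : ℕ} (hk : A.length = k) (B : List ℕ) {x y z : ℕ}
    (hyx : y < x) (hxz : x < z) :
    CKRel k (A ++ x :: y :: z :: B) (A ++ x :: z :: y :: B) (Equiv.swap (k + 1) (k + 2)) := by
  subst hk; exact Or.inl (CKMove.right A B hyx hxz)

theorem CKRel.braid {A : List ℕ} {k : ℕ} (hk : A.length = k) (B : List ℕ) (x : ℕ) :
    CKRel k (A ++ x :: (x + 1) :: x :: B) (A ++ (x + 1) :: x :: (x + 1) :: B)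
      (Equiv.swap k (k + 2)) := by
  subst hk; exact Or.inl (CKMove.braid A B x)

/-- At most one forced move. -/
def StepsTo (v : List ℕ) (m : ℕ) (u : List ℕ) (p : ℕ) : Prop :=
  (u = v ∧ p = m) ∨ ForcedMove v m u p

theorem StepsTo.refl (v : List ℕ) (m : ℕ) : StepsTo v m v m := Or.inl ⟨rfl, rfl⟩

theorem StepsTo.of_adjacent_left (A B : List ℕ) {x y : ℕ} (h : x + 1 = y) :
    StepsTo (A ++ x :: y :: B) A.length (A ++ y :: y :: B) (A.length + 1) := by
  subst h
  exact Or.inr ⟨by simp only [incrAt_append_length, incrAt_cons_zero], by omega, by simp,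
    crossingRefl_eq_of_adjacent _ _ _⟩

theorem StepsTo.of_adjacent_right (A B : List ℕ) {x y : ℕ} (h : y + 1 = x) :
    StepsTo (A ++ x :: y :: B) (A.length + 1) (A ++ x :: x :: B) A.length := by
  subst h
  exact Or.inr ⟨by simp only [incrAt_append_right, incrAt_cons_one, incrAt_cons_zero], by omega,
    by simp, (crossingRefl_eq_of_adjacent _ _ _).symm⟩

theorem StepsTo.of_adjacent_left' (A B : List ℕ) {t x y : ℕ} (h : x + 1 = y) :
    StepsTo (A ++ t :: x :: y :: B) (A.length + 1) (A ++ t :: y :: y :: B) (A.length + 2) := by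
  simpa using StepsTo.of_adjacent_left (A ++ [t]) B h

theorem StepsTo.of_adjacent_right' (A B : List ℕ) {t x y : ℕ} (h : y + 1 = x) :
    StepsTo (A ++ t :: x :: y :: B) (A.length + 2) (A ++ t :: x :: x :: B) (A.length + 1) := by
  simpa using StepsTo.of_adjacent_right (A ++ [t]) B h

theorem StepsTo.of_commute_left (A B : List ℕ) {x y z : ℕ} (h : x + 1 = z)
    (hc : sT z * sT y = sT y * sT z) :
    StepsTo (A ++ x :: y :: z :: B) A.length (A ++ z :: y :: z :: B) (A.length + 2) := by
  subst h
  exact Or.inr ⟨by simp only [incrAt_append_length, incrAt_cons_zero], by omega, by simp,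
    crossingRefl_eq_of_commute _ _ hc⟩

theorem StepsTo.of_commute_right (A B : List ℕ) {x y z : ℕ} (h : z + 1 = x)
    (hc : sT x * sT y = sT y * sT x) :
    StepsTo (A ++ x :: y :: z :: B) (A.length + 2) (A ++ x :: y :: x :: B) A.length := by
  subst h
  exact Or.inr ⟨by simp only [incrAt_append_right, incrAt_cons_two, incrAt_cons_one,
    incrAt_cons_zero], by omega, by simp, (crossingRefl_eq_of_commute _ _ hc).symm⟩

/-- The states `(v, m)` and `(v', m')` of the bump reach, after at most one forced move each,
states which are matched by a Coxeter–Knuth move at `k` after the next increment. -/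
def Meet (k : ℕ) (v : List ℕ) (m : ℕ) (v' : List ℕ) (m' : ℕ) : Prop :=
  ∃ u p u' p' τ, StepsTo v m u p ∧ StepsTo v' m' u' p' ∧
    CKRel k (incrAt u p) (incrAt u' p') τ ∧ τ p = p'

theorem Meet.symm {k : ℕ} {v v' : List ℕ} {m m' : ℕ} (h : Meet k v m v' m') :
    Meet k v' m' v m := by
  obtain ⟨u, p, u', p', τ, h1, h2, h3, rfl⟩ := h
  exact ⟨u', τ p, u, p, τ, h2, h1, h3.symm, h3.involutive p⟩

theorem Meet.left {A B : List ℕ} {x y z m : ℕ} (hxz : x < z) (hzy : z < y) :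
    Meet A.length (A ++ x :: y :: z :: B) m (A ++ y :: x :: z :: B)
      (Equiv.swap A.length (A.length + 1) m) := by
  rcases lt_or_ge m A.length with hm | hm
  · have hσ : Equiv.swap A.length (A.length + 1) m = m :=
      Equiv.swap_apply_of_ne_of_ne (by omega) (by omega)
    rw [hσ]
    refine ⟨_, _, _, _, _, .refl _ _, .refl _ _, ?_, hσ⟩
    rw [incrAt_append_left _ hm, incrAt_append_left _ hm]
    exact CKRel.left (length_incrAt _ _) B hxz hzy
  obtain ⟨j, rfl⟩ := Nat.exists_eq_add_of_le hm
  rcases j with _ | _ | _ | j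
  · rw [add_zero, Equiv.swap_apply_left]
    by_cases h1 : x + 1 = z
    · by_cases h2 : z + 1 = y
      · refine ⟨_, _, _, _, Equiv.swap A.length (A.length + 2), .refl _ _,
          .of_adjacent_left' _ _ h1, ?_, Equiv.swap_apply_left _ _⟩
        subst h1 h2
        simp only [incrAt_append_length, incrAt_append_right, incrAt_cons_two, incrAt_cons_one,
          incrAt_cons_zero]
        exact CKRel.braid rfl B _
      · refine ⟨_, _, _, _, Equiv.swap A.length (A.length + 1),
          .of_commute_left _ _ h1 (sT_comm (by omega)),
          .of_adjacent_left' _ _ h1, ?_, Equiv.swap_apply_of_ne_of_ne (by omega) (by omega)⟩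
        simp only [incrAt_append_right, incrAt_cons_two, incrAt_cons_one, incrAt_cons_zero]
        exact CKRel.left rfl B (by omega) (by omega)
    · refine ⟨_, _, _, _, Equiv.swap A.length (A.length + 1), .refl _ _, .refl _ _, ?_,
        Equiv.swap_apply_left _ _⟩
      simp only [incrAt_append_length, incrAt_append_right, incrAt_cons_one, incrAt_cons_zero]
      exact CKRel.left rfl B (by omega) (by omega)
  · rw [zero_add, Equiv.swap_apply_right]
    refine ⟨_, _, _, _, Equiv.swap A.length (A.length + 1), .refl _ _, .refl _ _, ?_,
      Equiv.swap_apply_right _ _⟩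
    simp only [incrAt_append_length, incrAt_append_right, incrAt_cons_one, incrAt_cons_zero]
    exact CKRel.left rfl B (by omega) (by omega)
  · rw [Equiv.swap_apply_of_ne_of_ne (by omega) (by omega), zero_add, one_add_one_eq_two]
    by_cases h1 : z + 1 = y
    · refine ⟨_, _, _, _, Equiv.swap A.length (A.length + 1), .of_adjacent_right' _ _ h1,
        .of_commute_right _ _ h1 (sT_comm (by omega)).symm, ?_, Equiv.swap_apply_right _ _⟩
      simp only [incrAt_append_length, incrAt_append_right, incrAt_cons_one, incrAt_cons_zero]
      exact CKRel.left rfl B (by omega) (by omega)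
    · refine ⟨_, _, _, _, Equiv.swap A.length (A.length + 1), .refl _ _, .refl _ _, ?_,
        Equiv.swap_apply_of_ne_of_ne (by omega) (by omega)⟩
      simp only [incrAt_append_right, incrAt_cons_two, incrAt_cons_one, incrAt_cons_zero]
      exact CKRel.left rfl B (by omega) (by omega)
  · have hσ := Equiv.swap_apply_of_ne_of_ne (a := A.length) (b := A.length + 1)
      (x := A.length + (j + 1 + 1 + 1)) (by omega) (by omega)
    rw [hσ]
    refine ⟨_, _, _, _, _, .refl _ _, .refl _ _, ?_, hσ⟩
    simp only [incrAt_append_right, incrAt_cons_succ]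
    exact CKRel.left rfl _ hxz hzy

theorem Meet.right {A B : List ℕ} {x y z m : ℕ} (hyx : y < x) (hxz : x < z) :
    Meet A.length (A ++ x :: y :: z :: B) m (A ++ x :: z :: y :: B)
      (Equiv.swap (A.length + 1) (A.length + 2) m) := by
  rcases lt_or_ge m A.length with hm | hm
  · have hσ : Equiv.swap (A.length + 1) (A.length + 2) m = m :=
      Equiv.swap_apply_of_ne_of_ne (by omega) (by omega)
    rw [hσ]
    refine ⟨_, _, _, _, _, .refl _ _, .refl _ _, ?_, hσ⟩
    rw [incrAt_append_left _ hm, incrAt_append_left _ hm]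
    exact CKRel.right (length_incrAt _ _) B hyx hxz
  obtain ⟨j, rfl⟩ := Nat.exists_eq_add_of_le hm
  rcases j with _ | _ | _ | j
  · rw [Equiv.swap_apply_of_ne_of_ne (by omega) (by omega), add_zero]
    by_cases h1 : x + 1 = z
    · refine ⟨_, _, _, _, Equiv.swap (A.length + 1) (A.length + 2),
        .of_commute_left _ _ h1 (sT_comm (by omega)).symm, .of_adjacent_left _ _ h1, ?_,
        Equiv.swap_apply_right _ _⟩
      simp only [incrAt_append_right, incrAt_cons_two, incrAt_cons_one, incrAt_cons_zero]
      exact CKRel.right rfl B (by omega) (by omega)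
    · refine ⟨_, _, _, _, Equiv.swap (A.length + 1) (A.length + 2), .refl _ _, .refl _ _, ?_,
        Equiv.swap_apply_of_ne_of_ne (by omega) (by omega)⟩
      simp only [incrAt_append_length, incrAt_cons_zero]
      exact CKRel.right rfl B (by omega) (by omega)
  · rw [zero_add, Equiv.swap_apply_left]
    by_cases h1 : y + 1 = x
    · by_cases h2 : x + 1 = z
      · refine ⟨_, _, _, _, Equiv.swap A.length (A.length + 2), .of_adjacent_right _ _ h1,
          .refl _ _, ?_, Equiv.swap_apply_left _ _⟩
        subst h1 h2
        simp only [incrAt_append_length, incrAt_append_right, incrAt_cons_two, incrAt_cons_one,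
          incrAt_cons_zero]
        exact (CKRel.braid rfl B _).symm
      · refine ⟨_, _, _, _, Equiv.swap (A.length + 1) (A.length + 2), .of_adjacent_right _ _ h1,
          .of_commute_right _ _ h1 (sT_comm (by omega)), ?_,
          Equiv.swap_apply_of_ne_of_ne (by omega) (by omega)⟩
        simp only [incrAt_append_length, incrAt_cons_zero]
        exact CKRel.right rfl B (by omega) (by omega)
    · refine ⟨_, _, _, _, Equiv.swap (A.length + 1) (A.length + 2), .refl _ _, .refl _ _, ?_,
        Equiv.swap_apply_left _ _⟩
      simp only [incrAt_append_right, incrAt_cons_two, incrAt_cons_one, incrAt_cons_zero]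
      exact CKRel.right rfl B (by omega) (by omega)
  · rw [zero_add, one_add_one_eq_two, Equiv.swap_apply_right]
    refine ⟨_, _, _, _, Equiv.swap (A.length + 1) (A.length + 2), .refl _ _, .refl _ _, ?_,
      Equiv.swap_apply_right _ _⟩
    simp only [incrAt_append_right, incrAt_cons_two, incrAt_cons_one, incrAt_cons_zero]
    exact CKRel.right rfl B (by omega) (by omega)
  · have hσ := Equiv.swap_apply_of_ne_of_ne (a := A.length + 1) (b := A.length + 2)
      (x := A.length + (j + 1 + 1 + 1)) (by omega) (by omega)
    rw [hσ]
    refine ⟨_, _, _, _, _, .refl _ _, .refl _ _, ?_, hσ⟩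
    simp only [incrAt_append_right, incrAt_cons_succ]
    exact CKRel.right rfl _ hyx hxz

theorem not_isReducedSelf_of_adjacent (A B : List ℕ) (x : ℕ) :
    ¬ IsReducedSelf (A ++ x :: x :: B) := fun h =>
  h.crossingRefl_ne (p := A.length) (q := A.length + 1) (by omega) (by simp) (by simp)
    (crossingRefl_eq_of_adjacent A B x)

theorem Meet.braid {A B : List ℕ} {x m : ℕ}
    (hv : NearlyReduced (A ++ x :: (x + 1) :: x :: B) m) :
    Meet A.length (A ++ x :: (x + 1) :: x :: B) m (A ++ (x + 1) :: x :: (x + 1) :: B)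
      (Equiv.swap A.length (A.length + 2) m) := by
  rcases lt_or_ge m A.length with hm | hm
  · have hσ : Equiv.swap A.length (A.length + 2) m = m :=
      Equiv.swap_apply_of_ne_of_ne (by omega) (by omega)
    rw [hσ]
    refine ⟨_, _, _, _, _, .refl _ _, .refl _ _, ?_, hσ⟩
    rw [incrAt_append_left _ hm, incrAt_append_left _ hm]
    exact CKRel.braid (length_incrAt _ _) B x
  obtain ⟨j, rfl⟩ := Nat.exists_eq_add_of_le hm
  rcases j with _ | _ | _ | j
  · rw [add_zero, Equiv.swap_apply_left]
    refine ⟨_, _, _, _, Equiv.swap (A.length + 1) (A.length + 2), .of_adjacent_left _ _ rfl,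
      .refl _ _, ?_, Equiv.swap_apply_left _ _⟩
    simp only [incrAt_append_right, incrAt_cons_two, incrAt_cons_one, incrAt_cons_zero]
    exact (CKRel.right rfl B (by omega) (by omega)).symm
  · refine (not_isReducedSelf_of_adjacent A B x ?_).elim
    simpa [List.eraseIdx_append_of_length_le] using hv.red
  · rw [zero_add, one_add_one_eq_two, Equiv.swap_apply_right]
    refine ⟨_, _, _, _, Equiv.swap A.length (A.length + 1), .of_adjacent_right' _ _ rfl,
      .refl _ _, ?_, Equiv.swap_apply_right _ _⟩
    simp only [incrAt_append_length, incrAt_append_right, incrAt_cons_one, incrAt_cons_zero]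
    exact CKRel.left rfl B (by omega) (by omega)
  · have hσ := Equiv.swap_apply_of_ne_of_ne (a := A.length) (b := A.length + 2)
      (x := A.length + (j + 1 + 1 + 1)) (by omega) (by omega)
    rw [hσ]
    refine ⟨_, _, _, _, _, .refl _ _, .refl _ _, ?_, hσ⟩
    simp only [incrAt_append_right, incrAt_cons_succ]
    exact CKRel.braid rfl _ x

theorem CKRel.meet {k : ℕ} {v v' : List ℕ} {σ : Equiv.Perm ℕ} (h : CKRel k v v' σ) {m : ℕ}
    (hv : NearlyReduced v m) : Meet k v m v' (σ m) := by
  have key : ∀ {u u' : List ℕ} {p : ℕ}, CKMove k u u' σ → NearlyReduced u p →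
      Meet k u p u' (σ p) := by
    intro u u' p h hu
    cases h with
    | left A B hxz hzy => exact Meet.left hxz hzy
    | right A B hyx hxz => exact Meet.right hyx hxz
    | braid A B x => exact Meet.braid hu
  have hv' := h.nearlyReduced hv
  have hinv := h.involutive m
  rcases h with h | h
  · exact key h hv
  · simpa [hinv] using (key h hv').symm

theorem StepsTo.nearlyReduced {v u : List ℕ} {m p : ℕ} (h : StepsTo v m u p)
    (hv : NearlyReduced v m) : NearlyReduced u p := by
  rcases h with ⟨rfl, rfl⟩ | h
  · exact hv
  · exact h.nearlyReduced hv

theorem StepsTo.bump {v u : List ℕ} {m p n : ℕ} {b : List ℕ} (h : StepsTo v m u p)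
    (hm : m < v.length) (hb : Bump n u p b) : ∃ n', Bump n' v m b := by
  rcases h with ⟨rfl, rfl⟩ | h
  · exact ⟨n, hb⟩
  · exact ⟨n + 1, h.bump hm hb⟩

theorem Bump.of_stepsTo {v u : List ℕ} {m p n : ℕ} {b : List ℕ} (hb : Bump n v m b)
    (hv : NearlyReduced v m) (h : StepsTo v m u p) : ∃ n', n' ≤ n ∧ Bump n' u p b := by
  rcases h with ⟨rfl, rfl⟩ | h
  · exact ⟨n, le_rfl, hb⟩
  · obtain ⟨n', hn, hb'⟩ := hb.of_forcedMove hv h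
    exact ⟨n', hn.le, hb'⟩

/-- Little bumps commute with Coxeter–Knuth moves. -/
theorem Bump.commute_ckRel {n k m : ℕ} {v v' b : List ℕ} {σ : Equiv.Perm ℕ} (hb : Bump n v m b)
    (hv : NearlyReduced v m) (h : CKRel k v v' σ) :
    ∃ b' n' τ, Bump n' v' (σ m) b' ∧ CKRel k b b' τ := by
  induction n using Nat.strong_induction_on generalizing v v' m σ with
  | _ n ih =>
  have hv' := h.nearlyReduced hv
  obtain ⟨u, p, u', p', τ, hu, hu', hck, rfl⟩ := h.meet hv
  have hup := hu.nearlyReduced hv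
  obtain ⟨n₁, hn₁, hb₁⟩ := hb.of_stepsTo hv hu
  suffices ∃ b' n' ρ, Bump n' u' (τ p) b' ∧ CKRel k b b' ρ by
    obtain ⟨b', n', ρ, hb', hρ⟩ := this
    obtain ⟨n'', hb''⟩ := hu'.bump hv'.lt hb'
    exact ⟨b', n'', ρ, hb'', hρ⟩
  cases hb₁ with
  | halt hred => exact ⟨_, 1, τ, Bump.halt (hck.isReducedSelf hred), hck⟩
  | @step n₂ _ _ q _ hnred hne heq hb₂ =>
    obtain ⟨b', n', ρ, hb', hρ⟩ := ih n₂ (by omega) hb₂ (hup.incrAt.move heq) hck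
    refine ⟨b', n' + 1, ρ, Bump.step (fun hr => hnred (hck.symm.isReducedSelf hr))
      (fun he => hne (τ.injective he)) ?_ hb', hρ⟩
    rw [← hck.crossingRefl_eq, ← hck.crossingRefl_eq, heq]

/-! ### Little bumps preserve descents -/

theorem getD_incrAt {v : List ℕ} {m : ℕ} (hm : m < v.length) (k : ℕ) :
    (incrAt v m).getD k 0 = if k = m then v.getD k 0 + 1 else v.getD k 0 := by
  unfold incrAt
  split_ifs with h
  · subst h; simp [List.getD, hm]
  · simp [List.getD, List.getElem?_set_ne (Ne.symm h)]

theorem crossingRefl_eq_of_getD_eq {v : List ℕ} {k : ℕ} (hk : k + 1 < v.length)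
    (h : v.getD k 0 = v.getD (k + 1) 0) : crossingRefl v k = crossingRefl v (k + 1) := by
  rw [List.getD_eq_getElem _ _ hk, List.getD_eq_getElem _ _ (by omega)] at h
  have hv : v = v.take k ++ v[k] :: v[k] :: v.drop (k + 1 + 1) := by
    conv_lhs => rw [← List.take_append_drop k v, List.drop_eq_getElem_cons (by omega),
      List.drop_eq_getElem_cons hk, ← h]
  have hl : (v.take k).length = k := by simp; omega
  have := crossingRefl_eq_of_adjacent (v.take k) (v.drop (k + 1 + 1)) v[k]
  rwa [← hv, hl] at this

theorem IsReducedSelf.getD_ne {v : List ℕ} (hv : IsReducedSelf v) {k : ℕ}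
    (hk : k + 1 < v.length) : v.getD k 0 ≠ v.getD (k + 1) 0 := fun h =>
  hv.crossingRefl_ne (by omega) (by omega) hk (crossingRefl_eq_of_getD_eq hk h)

theorem Bump.ascent {n m k : ℕ} {v b : List ℕ} (hb : Bump n v m b) (hv : NearlyReduced v m)
    (hk : k + 1 < v.length)
    (h : v.getD k 0 < v.getD (k + 1) 0 ∨ v.getD k 0 = v.getD (k + 1) 0 ∧ m = k + 1) :
    b.getD k 0 < b.getD (k + 1) 0 := by
  induction hb with
  | halt hred =>
    have hne := hred.getD_ne (k := k) (by rwa [length_incrAt])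
    rw [getD_incrAt hv.lt, getD_incrAt hv.lt] at hne ⊢
    split_ifs at hne ⊢ <;> omega
  | @step n v m m' b hnred hne heq hb ih =>
    have hk' : k + 1 < (BPDPaper.incrAt v m).length := by rwa [length_incrAt]
    refine ih (hv.incrAt.move heq) hk' ?_
    by_cases he : (BPDPaper.incrAt v m).getD k 0 = (BPDPaper.incrAt v m).getD (k + 1) 0
    · have hr := crossingRefl_eq_of_getD_eq hk' he
      rw [getD_incrAt hv.lt, getD_incrAt hv.lt] at he
      have hmk : m = k := by split_ifs at he <;> omega
      subst hmk
      refine Or.inr ⟨by rwa [getD_incrAt hv.lt, getD_incrAt hv.lt], ?_⟩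
      exact crossingRefl_unique hv.incrAt.pos hv.incrAt.lt hv.incrAt.red hne (by omega) heq hr
    · left
      rw [getD_incrAt hv.lt, getD_incrAt hv.lt] at he ⊢
      split_ifs at he ⊢ <;> omega

theorem Bump.descent {n m k : ℕ} {v b : List ℕ} (hb : Bump n v m b) (hv : NearlyReduced v m)
    (hk : k + 1 < v.length)
    (h : v.getD (k + 1) 0 < v.getD k 0 ∨ v.getD k 0 = v.getD (k + 1) 0 ∧ m = k) :
    b.getD (k + 1) 0 < b.getD k 0 := by
  induction hb with
  | halt hred =>
    have hne := hred.getD_ne (k := k) (by rwa [length_incrAt])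
    rw [getD_incrAt hv.lt, getD_incrAt hv.lt] at hne ⊢
    split_ifs at hne ⊢ <;> omega
  | @step n v m m' b hnred hne heq hb ih =>
    have hk' : k + 1 < (BPDPaper.incrAt v m).length := by rwa [length_incrAt]
    refine ih (hv.incrAt.move heq) hk' ?_
    by_cases he : (BPDPaper.incrAt v m).getD k 0 = (BPDPaper.incrAt v m).getD (k + 1) 0
    · have hr := crossingRefl_eq_of_getD_eq hk' he
      rw [getD_incrAt hv.lt, getD_incrAt hv.lt] at he
      have hmk : m = k + 1 := by split_ifs at he <;> omega
      subst hmk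
      refine Or.inr ⟨by rwa [getD_incrAt hv.lt, getD_incrAt hv.lt], ?_⟩
      exact crossingRefl_unique hv.incrAt.pos hv.incrAt.lt hv.incrAt.red hne (by omega) heq
        hr.symm
    · left
      rw [getD_incrAt hv.lt, getD_incrAt hv.lt] at he ⊢
      split_ifs at he ⊢ <;> omega

/-- `b` is obtained from the reduced word `a` by a Little bump. -/
structure BumpRel (a b : List ℕ) : Prop where
  red : IsReducedSelf a
  bump : ∃ m n, NearlyReduced a m ∧ Bump n a m b

theorem BumpRel.ckRel {k : ℕ} {a a' b : List ℕ} {σ : Equiv.Perm ℕ} (h : BumpRel a b)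
    (hck : CKRel k a a' σ) : ∃ b' τ, CKRel k b b' τ ∧ BumpRel a' b' := by
  obtain ⟨hred, m, n, hm, hb⟩ := h
  obtain ⟨b', n', τ, hb', hτ⟩ := hb.commute_ckRel hm hck
  exact ⟨b', τ, hτ, hck.isReducedSelf hred, σ m, n', hck.nearlyReduced hm, hb'⟩

theorem BumpRel.lt_or_gt {A B A' B' : List ℕ} {x y x' y' : ℕ}
    (h : BumpRel (A ++ x :: y :: B) (A' ++ x' :: y' :: B')) (hA : A.length = A'.length) :
    x < y ∧ x' < y' ∨ y < x ∧ y' < x' := by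
  obtain ⟨hred, m, n, hm, hb⟩ := h
  have hk : A.length + 1 < (A ++ x :: y :: B).length := by simp
  have hne := hred.getD_ne hk
  have hasc := hb.ascent hm hk
  have hdesc := hb.descent hm hk
  have e0 : (A' ++ x' :: y' :: B').getD A.length 0 = x' := by simp [hA, List.getD]
  have e1 : (A' ++ x' :: y' :: B').getD (A.length + 1) 0 = y' := by simp [hA, List.getD]
  have e2 : (A ++ x :: y :: B).getD A.length 0 = x := by simp [List.getD]
  have e3 : (A ++ x :: y :: B).getD (A.length + 1) 0 = y := by simp [List.getD]
  rw [e2, e3] at hne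
  rw [e0, e1, e2, e3] at hasc hdesc
  rcases lt_or_gt_of_ne hne with h | h
  · exact Or.inl ⟨h, hasc (Or.inl h)⟩
  · exact Or.inr ⟨h, hdesc (Or.inl h)⟩

/-! ### Edelman–Greene insertion by Coxeter–Knuth moves -/

/-- The Coxeter–Knuth move performed on the last two entries of a column and a smaller letter. -/
def ColStep (c d x c' e z : ℕ) : Prop :=
  (x < c ∧ c' = c ∧ e = x ∧ z = d) ∨ (c < x ∧ c' = d ∧ e = c ∧ z = x) ∨
    (x = c ∧ d = c + 1 ∧ c' = d ∧ e = c ∧ z = d)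

theorem CKRel.colStep {A B w : List ℕ} {k c d x : ℕ} {σ : Equiv.Perm ℕ} (hk : A.length = k)
    (h : CKRel k (A ++ c :: d :: x :: B) w σ) (hcd : c < d) (hxd : x < d) :
    ∃ c' e z, w = A ++ c' :: e :: z :: B ∧ ColStep c d x c' e z := by
  generalize hv : A ++ c :: d :: x :: B = v at h
  rcases h with h | h <;> cases h <;>
    obtain ⟨rfl, h⟩ := List.append_inj hv (by omega) <;>
    simp only [List.cons.injEq] at h <;> obtain ⟨rfl, rfl, rfl, rfl⟩ := h <;>
    first
    | omega
    | exact ⟨_, _, _, rfl, by unfold ColStep; omega⟩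

theorem exists_ckRel {A B : List ℕ} {c d x : ℕ} (hred : IsReducedSelf (A ++ c :: d :: x :: B))
    (hcd : c < d) (hxd : x < d) : ∃ w σ, CKRel A.length (A ++ c :: d :: x :: B) w σ := by
  rcases lt_trichotomy x c with h | rfl | h
  · exact ⟨_, _, (CKRel.right rfl B h hcd).symm⟩
  · by_cases hd : d = x + 1
    · subst hd
      exact ⟨_, _, CKRel.braid rfl B x⟩
    · refine (hred.crossingRefl_ne (p := A.length) (q := A.length + 2) (by omega) (by simp)
        (by simp) (crossingRefl_eq_of_commute A B (sT_comm ?_))).elim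
      omega
  · exact ⟨_, _, CKRel.left rfl B h hxd⟩

theorem colIns_append {C : List ℕ} {x : ℕ} (h : ∀ c ∈ C, c < x) :
    colIns x C = (C ++ [x], none) := by
  simp only [colIns]
  rw [if_pos (by simpa using h)]

theorem colIns_bump_last {C : List ℕ} {x d : ℕ} (h : ∀ c ∈ C, c < x) (hd : x < d) :
    colIns x (C ++ [d]) = (C ++ [x], some d) := by
  have h1 : C.find? (fun c => decide (x < c)) = none := by
    simp only [List.find?_eq_none, decide_eq_true_eq]
    intro c hc
    exact (h c hc).le.not_gt
  have h2 : C.map (fun c => if c = d then x else c) = C := by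
    conv_rhs => rw [← List.map_id C]
    refine List.map_congr_left fun c hc => ?_
    have := h c hc
    rw [if_neg (by omega), id]
  simp only [colIns]
  rw [if_neg (by simp; intros; omega), if_neg]
  · simp [List.find?_append, h1, h2, hd]
  · rintro ⟨hx, -⟩
    rcases List.mem_append.1 hx with hx | hx
    · exact lt_irrefl _ (h x hx)
    · simp at hx; omega

theorem colIns_append_last {C E : List ℕ} {x c d y : ℕ} (hC : (C ++ [c]).Pairwise (· < ·))
    (hxc : x < c) (hcd : c < d) (h : colIns x (C ++ [c]) = (E, some y)) :
    colIns x (C ++ [c] ++ [d]) = (E ++ [d], some y) := by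
  have hlt : ∀ e ∈ C ++ [c], e < d := by
    intro e he
    rw [List.pairwise_append] at hC
    rcases List.mem_append.1 he with he | he
    · exact (hC.2.2 e he c (by simp)).trans hcd
    · simp at he; omega
  simp only [colIns] at h ⊢
  rw [if_neg (by simp; intros; omega)] at h ⊢
  have hmem : (x ∈ C ++ [c] ++ [d] ∧ x + 1 ∈ C ++ [c] ++ [d]) ↔
      (x ∈ C ++ [c] ∧ x + 1 ∈ C ++ [c]) := by
    rw [List.mem_append (s := C ++ [c]), List.mem_append (s := C ++ [c])]
    simp only [List.mem_singleton (b := d)]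
    constructor
    · rintro ⟨h1, h2⟩
      exact ⟨h1.resolve_right (by omega), h2.resolve_right (by omega)⟩
    · rintro ⟨h1, h2⟩
      exact ⟨Or.inl h1, Or.inl h2⟩
  rw [List.find?_append]
  simp only [hmem]
  split_ifs at h ⊢ with hm
  · simp only [Prod.mk.injEq] at h ⊢
    exact ⟨by rw [h.1], h.2⟩
  · cases hf : (C ++ [c]).find? (fun c => decide (x < c)) with
    | none =>
      rw [List.find?_eq_none] at hf
      have := hf c (by simp)
      simp at this; omega
    | some f =>
      rw [hf] at h
      have hfd := hlt f (List.mem_of_find?_eq_some hf)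
      simp only [Prod.mk.injEq] at h
      obtain ⟨h1, h2⟩ := h
      simp only [Option.some_or]
      rw [List.map_append, h1, h2]
      simp [hfd.ne']

theorem colIns_double {C : List ℕ} {c : ℕ} :
    colIns c (C ++ [c] ++ [c + 1]) = (C ++ [c] ++ [c + 1], some (c + 1)) := by
  simp only [colIns]
  rw [if_neg (by simp), if_pos (by simp)]

theorem mem_of_colIns {C E : List ℕ} {x : ℕ} {o : Option ℕ} (h : colIns x C = (E, o)) {e : ℕ}
    (he : e ∈ E) : e ∈ C ∨ e = x := by
  unfold colIns at h
  split_ifs at h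
  · simp only [Prod.mk.injEq] at h
    rw [← h.1] at he
    simpa using he
  · simp only [Prod.mk.injEq] at h
    rw [← h.1] at he
    exact Or.inl he
  · split at h <;> simp only [Prod.mk.injEq] at h <;> rw [← h.1] at he
    · obtain ⟨f, hf, rfl⟩ := List.mem_map.1 he
      split_ifs
      · exact Or.inr rfl
      · exact Or.inl hf
    · exact Or.inl he

theorem pairwise_append_singleton {C : List ℕ} {c : ℕ} :
    (C ++ [c]).Pairwise (· < ·) ↔ C.Pairwise (· < ·) ∧ ∀ e ∈ C, e < c := by
  simp [List.pairwise_append]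

theorem ColStep.pairwise {C : List ℕ} {c d x c' e z : ℕ} (h : ColStep c d x c' e z)
    (hC : (C ++ [c] ++ [d]).Pairwise (· < ·)) : (C ++ [c']).Pairwise (· < ·) := by
  simp only [pairwise_append_singleton, List.mem_append, List.mem_singleton] at hC ⊢
  refine ⟨hC.1.1, fun f hf => ?_⟩
  have := hC.1.2 f hf
  have := hC.2 f (Or.inl hf)
  rcases h with h | h | h <;> omega

theorem ColStep.colIns {C E : List ℕ} {c d x c' e z y : ℕ} (h : ColStep c d x c' e z)
    (hC : (C ++ [c] ++ [d]).Pairwise (· < ·)) (hxd : x < d)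
    (hE : colIns e (C ++ [c']) = (E, some y)) (hEp : E.Pairwise (· < ·)) :
    colIns x (C ++ [c] ++ [d]) = (E ++ [z], some y) ∧ (E ++ [z]).Pairwise (· < ·) := by
  obtain ⟨hC1, hCd⟩ := pairwise_append_singleton.1 hC
  obtain ⟨hC0, hCc⟩ := pairwise_append_singleton.1 hC1
  have hcd : c < d := hCd c (by simp)
  rcases h with ⟨hxc, rfl, rfl, rfl⟩ | ⟨hcx, rfl, rfl, rfl⟩ | ⟨rfl, rfl, rfl, rfl, rfl⟩
  · refine ⟨colIns_append_last hC1 hxc hcd hE, pairwise_append_singleton.2 ⟨hEp, ?_⟩⟩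
    intro f hf
    rcases mem_of_colIns hE hf with hf | rfl
    · exact hCd f hf
    · exact hxd
  · rw [colIns_bump_last hCc hcd, Prod.mk.injEq] at hE
    obtain ⟨rfl, hy⟩ := hE
    rw [← hy]
    have hlt : ∀ f ∈ C ++ [e], f < z := by
      intro f hf
      rcases List.mem_append.1 hf with hf | hf
      · exact (hCc f hf).trans hcx
      · simp at hf; omega
    exact ⟨colIns_bump_last hlt hxd, pairwise_append_singleton.2 ⟨hC1, hlt⟩⟩
  · rw [colIns_bump_last hCc hcd, Prod.mk.injEq] at hE
    obtain ⟨rfl, hy⟩ := hE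
    rw [← hy]
    exact ⟨colIns_double, hC⟩

theorem ColStep.lt {c d x c' e z : ℕ} (h : ColStep c d x c' e z) (hcd : c < d) : e < c' := by
  rcases h with h | h | h <;> omega

/-- Inserting corresponding letters that do not create a box in corresponding columns of two words
related by a Little bump. -/
theorem BumpRel.colIns {A A' B B' C D : List ℕ} {x x' c d : ℕ} (hAA : A.length = A'.length)
    (hCD : C.length = D.length) (hC : (C ++ [c]).Pairwise (· < ·))
    (hD : (D ++ [d]).Pairwise (· < ·)) (hxc : x < c)
    (h : BumpRel (A ++ C ++ c :: x :: B) (A' ++ D ++ d :: x' :: B')) :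
    ∃ E E' y y', colIns x (C ++ [c]) = (E, some y) ∧ colIns x' (D ++ [d]) = (E', some y') ∧
      E.length = C.length + 1 ∧ E'.length = D.length + 1 ∧
      E.Pairwise (· < ·) ∧ E'.Pairwise (· < ·) ∧
      BumpRel (A ++ y :: (E ++ B)) (A' ++ y' :: (E' ++ B')) := by
  induction C using List.reverseRecOn generalizing D x x' c d B B' with
  | nil =>
    obtain rfl : D = [] := by simpa using hCD.symm
    simp only [List.append_nil] at h
    have hxd : x' < d := by
      rcases h.lt_or_gt hAA with h | h <;> omega
    exact ⟨[x], [x'], c, d, colIns_bump_last (C := []) (by simp) hxc,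
      colIns_bump_last (C := []) (by simp) hxd, rfl, rfl, by simp, by simp, by simpa using h⟩
  | append_singleton C c₀ ih =>
    obtain ⟨D, d₀, rfl⟩ : ∃ D' d₀, D = D' ++ [d₀] := by
      rcases List.eq_nil_or_concat D with rfl | ⟨D', d₀, rfl⟩
      · simp at hCD
      · exact ⟨D', d₀, by simp⟩
    have hCD' : C.length = D.length := by simpa using hCD
    have hxd : x' < d := by
      rcases h.lt_or_gt (by simp [hAA, hCD']) with h | h <;> omega
    have hc : c₀ < c := (pairwise_append_singleton.1 hC).2 c₀ (by simp)
    have hd : d₀ < d := (pairwise_append_singleton.1 hD).2 d₀ (by simp)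
    have hl : (A' ++ D).length = (A ++ C).length := by simp [hAA, hCD']
    have h' : BumpRel ((A ++ C) ++ c₀ :: c :: x :: B) ((A' ++ D) ++ d₀ :: d :: x' :: B') := by
      simpa using h
    obtain ⟨w, σ, hw⟩ := exists_ckRel h'.red hc hxc
    obtain ⟨w', τ, hw', hww⟩ := h'.ckRel hw
    obtain ⟨c', e, z, rfl, hs⟩ := hw.colStep rfl hc hxc
    obtain ⟨d', e', z', rfl, hs'⟩ := hw'.colStep hl hd hxd
    obtain ⟨E, E', y, y', hE, hE', hlE, hlE', hp, hp', hR⟩ :=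
      ih hCD' (hs.pairwise hC) (hs'.pairwise hD) (hs.lt hc) hww
    obtain ⟨h1, h2⟩ := hs.colIns hC hxc hE hp
    obtain ⟨h3, h4⟩ := hs'.colIns hD hxd hE' hp'
    exact ⟨_, _, y, y', h1, h3, by simp [hlE], by simp [hlE'], h2, h4, by simpa using hR⟩

/-- The reading word of a tableau given by its columns: the columns from right to left. -/
def readCols : List (List ℕ) → List ℕ
  | [] => []
  | C :: T => readCols T ++ C

theorem length_readCols_eq {T T' : List (List ℕ)} (h : T.map List.length = T'.map List.length) :
    (readCols T).length = (readCols T').length := by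
  induction T generalizing T' with
  | nil => cases T' <;> simp_all
  | cons C T ih =>
    cases T' with
    | nil => simp at h
    | cons D T' =>
      simp only [List.map_cons, List.cons.injEq] at h
      simp [readCols, ih h.2, h.1]

theorem egInsert_cons_none {C C' : List ℕ} {T : List (List ℕ)} {x : ℕ}
    (h : colIns x C = (C', none)) : egInsert (C :: T) x = (C' :: T, 0) := by
  simp [egInsert, h]

theorem egInsert_cons_some {C C' : List ℕ} {T : List (List ℕ)} {x y : ℕ}
    (h : colIns x C = (C', some y)) :
    egInsert (C :: T) x = (C' :: (egInsert T y).1, (egInsert T y).2 + 1) := by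
  simp [egInsert, h]

/-- Insertion into two tableaux of the same shape whose reading words are related by a Little bump
creates boxes in the same column. -/
theorem BumpRel.egInsert {T T' : List (List ℕ)} {x x' : ℕ} {B B' : List ℕ}
    (hshape : T.map List.length = T'.map List.length) (hT : ∀ C ∈ T, C.Pairwise (· < ·))
    (hT' : ∀ C ∈ T', C.Pairwise (· < ·))
    (h : BumpRel (readCols T ++ x :: B) (readCols T' ++ x' :: B')) :
    (egInsert T x).2 = (egInsert T' x').2 ∧
      (egInsert T x).1.map List.length = (egInsert T' x').1.map List.length ∧
      (∀ C ∈ (egInsert T x).1, C.Pairwise (· < ·)) ∧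
      (∀ C ∈ (egInsert T' x').1, C.Pairwise (· < ·)) ∧
      BumpRel (readCols (egInsert T x).1 ++ B) (readCols (egInsert T' x').1 ++ B') := by
  induction T generalizing T' x x' B B' with
  | nil =>
    obtain rfl : T' = [] := by simpa using hshape.symm
    simpa [BPDPaper.egInsert, readCols] using h
  | cons C T ih =>
    cases T' with
    | nil => simp at hshape
    | cons D T' =>
    simp only [List.map_cons, List.cons.injEq] at hshape
    obtain ⟨hCD, hTT⟩ := hshape
    have hC := hT C (by simp)
    have hD := hT' D (by simp)
    have hTs : ∀ F ∈ T, F.Pairwise (· < ·) := fun F hF => hT F (by simp [hF])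
    have hTs' : ∀ F ∈ T', F.Pairwise (· < ·) := fun F hF => hT' F (by simp [hF])
    have hlen := length_readCols_eq hTT
    have happ : (∀ c ∈ C, c < x) → (∀ d ∈ D, d < x') →
        (BPDPaper.egInsert (C :: T) x).2 = (BPDPaper.egInsert (D :: T') x').2 ∧
        (BPDPaper.egInsert (C :: T) x).1.map List.length =
          (BPDPaper.egInsert (D :: T') x').1.map List.length ∧
        (∀ F ∈ (BPDPaper.egInsert (C :: T) x).1, F.Pairwise (· < ·)) ∧
        (∀ F ∈ (BPDPaper.egInsert (D :: T') x').1, F.Pairwise (· < ·)) ∧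
        BumpRel (readCols (BPDPaper.egInsert (C :: T) x).1 ++ B)
          (readCols (BPDPaper.egInsert (D :: T') x').1 ++ B') := by
      intro h1 h2
      rw [egInsert_cons_none (colIns_append h1), egInsert_cons_none (colIns_append h2)]
      refine ⟨rfl, by simp [hCD, hTT], ?_, ?_, by simpa [readCols] using h⟩
      · simp only [List.mem_cons, forall_eq_or_imp]
        exact ⟨pairwise_append_singleton.2 ⟨hC, h1⟩, hTs⟩
      · simp only [List.mem_cons, forall_eq_or_imp]
        exact ⟨pairwise_append_singleton.2 ⟨hD, h2⟩, hTs'⟩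
    rcases List.eq_nil_or_concat C with rfl | ⟨C, c, rfl⟩
    · obtain rfl : D = [] := by simpa using hCD.symm
      exact happ (by simp) (by simp)
    obtain ⟨D, d, rfl⟩ : ∃ D' d, D = D' ++ [d] := by
      rcases List.eq_nil_or_concat D with rfl | ⟨D', d, rfl⟩
      · simp at hCD
      · exact ⟨D', d, by simp⟩
    simp only [List.concat_eq_append] at *
    have hCD' : C.length = D.length := by simpa using hCD
    have h' : BumpRel (readCols T ++ C ++ c :: x :: B) (readCols T' ++ D ++ d :: x' :: B') := by
      simpa [readCols] using h
    rcases h'.lt_or_gt (by simp [hlen, hCD']) with ⟨hcx, hdx⟩ | ⟨hxc, -⟩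
    · have hlast : ∀ {F : List ℕ} {f t : ℕ}, (F ++ [f]).Pairwise (· < ·) → f < t →
          ∀ e ∈ F ++ [f], e < t := by
        intro F f t hF hft e he
        rcases List.mem_append.1 he with he | he
        · exact ((pairwise_append_singleton.1 hF).2 e he).trans hft
        · simp at he; omega
      exact happ (hlast hC hcx) (hlast hD hdx)
    · obtain ⟨E, E', y, y', hE, hE', hlE, hlE', hp, hp', hR⟩ :=
        h'.colIns hlen hCD' hC hD hxc
      obtain ⟨h1, h2, h3, h4, h5⟩ := ih hTT hTs hTs' hR
      rw [egInsert_cons_some hE, egInsert_cons_some hE']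
      refine ⟨by simp [h1], by simp [h2, hlE, hlE', hCD'], ?_, ?_, by simpa [readCols] using h5⟩
      · simp only [List.mem_cons, forall_eq_or_imp]
        exact ⟨hp, h3⟩
      · simp only [List.mem_cons, forall_eq_or_imp]
        exact ⟨hp', h4⟩

theorem BumpRel.foldl_egStep {T T' Q : List (List ℕ)} {r a b : List ℕ}
    (hab : a.length = b.length) (hshape : T.map List.length = T'.map List.length)
    (hT : ∀ C ∈ T, C.Pairwise (· < ·)) (hT' : ∀ C ∈ T', C.Pairwise (· < ·))
    (h : BumpRel (readCols T ++ a) (readCols T' ++ b)) :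
    ((r.zip a).foldl egStep (T, Q)).2 = ((r.zip b).foldl egStep (T', Q)).2 := by
  induction r generalizing T T' Q a b with
  | nil => simp
  | cons s r ih =>
    cases a with
    | nil =>
      obtain rfl : b = [] := by simpa using hab.symm
      simp
    | cons x a =>
      cases b with
      | nil => simp at hab
      | cons y b =>
        obtain ⟨h1, h2, h3, h4, h5⟩ := h.egInsert hshape hT hT'
        simp only [List.zip_cons_cons, List.foldl_cons, egStep, h1]
        exact ih (by simpa using hab) h2 h3 h4 h5

theorem BumpRel.qtilde_eq {P P' : Biword} (htop : P'.top = P.top) (h : BumpRel P.bot P'.bot) :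
    Qtilde P = Qtilde P' := by
  have hlen : P.bot.length = P'.bot.length := by
    obtain ⟨m, n, -, hb⟩ := h.bump
    exact hb.length_eq.symm
  unfold Qtilde egPQ
  rw [htop, BumpRel.foldl_egStep hlen rfl (by simp) (by simp) (by simpa [readCols] using h)]

theorem exists_bump_of_steps {ms : List ℕ} {ws : List (List ℕ)} (hms : ms ≠ [])
    (hlen : ws.length = ms.length + 1)
    (hstep : ∀ t, t < ms.length → ws.getD (t + 1) [] = incrAt (ws.getD t []) (ms.getD t 0))
    (hmove : ∀ t, t + 1 < ms.length →
      ¬ IsReducedSelf (ws.getD (t + 1) []) ∧ ms.getD (t + 1) 0 ≠ ms.getD t 0 ∧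
      crossingRefl (ws.getD (t + 1) []) (ms.getD t 0)
        = crossingRefl (ws.getD (t + 1) []) (ms.getD (t + 1) 0))
    (hred : IsReducedSelf (ws.getLastD [])) :
    ∃ n, Bump n (ws.getD 0 []) (ms.getD 0 0) (ws.getLastD []) := by
  induction ms generalizing ws with
  | nil => exact (hms rfl).elim
  | cons m ms ih =>
    match ws, hlen with
    | v :: u :: ws, hlen =>
    have hu : u = incrAt v m := by simpa using hstep 0 (by simp)
    cases ms with
    | nil =>
      obtain rfl : ws = [] := by simpa using hlen
      subst hu
      exact ⟨1, Bump.halt (by simpa using hred)⟩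
    | cons m' ms =>
      obtain ⟨h1, h2, h3⟩ := hmove 0 (by simp)
      obtain ⟨n, hn⟩ := ih (ws := u :: ws) (by simp) (by simpa using hlen)
        (fun t ht => by simpa using hstep (t + 1) (by simpa using ht))
        (fun t ht => by simpa using hmove (t + 1) (by simpa using ht)) (by simpa using hred)
      subst hu
      exact ⟨n + 1, Bump.step (by simpa using h1) (by simpa using h2) (by simpa using h3)
        (by simpa using hn)⟩

/-- For `ℓ(w t_{ij}) = ℓ(w) − 1` and `(r ; a) ∈ PD(w)`, the
Edelman–Greene recording tableau is invariant under the Little bump `L_{ij}`. -/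
theorem stmt8 (w : Perm') (hw : IsPerm w) (i j : ℕ) (hij : i < j)
    (hlen : plen (w * tT i j) + 1 = plen w)
    (P P' : Biword) (hP : IsCompatible w P) (hb : LittleBumpRel i j P P') :
    Qtilde P = Qtilde P' := by
  obtain ⟨htop, ms, ws, hms, hws, h0, hlast, hstep, hij', hmove, hred'⟩ := hb
  obtain ⟨⟨⟨hpos, rfl⟩, hPlen⟩, -⟩ := hP
  have hred : IsReducedSelf P.bot := ⟨⟨hpos, rfl⟩, hPlen⟩
  have hms' : 0 < ms.length := List.length_pos_iff.2 hms
  by_cases hm : ms.getD 0 0 < P.bot.length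
  · obtain ⟨n, hn⟩ := exists_bump_of_steps hms hws hstep hmove (hlast ▸ hred')
    rw [h0, hlast] at hn
    refine BumpRel.qtilde_eq htop ⟨hred, _, n, ⟨hpos, hm, ⟨⟨?_, rfl⟩, ?_⟩⟩, hn⟩
    · exact fun x hx => hpos x ((List.eraseIdx_sublist _ _).subset hx)
    · rw [List.length_eraseIdx_of_lt hm, wordProd_eraseIdx hm, hij']
      omega
  · -- A position beyond the word changes nothing, and the bump stops at once.
    have h1 : ws.getD 1 [] = P.bot := by
      rw [hstep 0 hms', h0, incrAt, List.set_eq_of_length_le (by omega)]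
    have hone : ms.length = 1 := by
      by_contra hne
      exact (hmove 0 (by omega)).1 (by rw [zero_add, h1]; exact hred)
    have hbot : P'.bot = P.bot := by
      rw [← hlast, ← h1]
      match ws, hws with
      | [_, _], _ => rfl
      | [], h => simp at h
      | [_], h => simp [hone] at h
      | _ :: _ :: _ :: _, h => simp [hone] at h
    cases P
    cases P'
    simp_all

end BPDPaper
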